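/- arXiv:1005.4252 — 4 statements merged into one kernel-verified Lean document; each statement's English description precedes it below -/
import Mathlib

section
/- For nonnegative integers a and b with a ≥ b, the alternating sum ∑_{r=-b}^{b} (-1)^r * C(2a, a-r) * C(2b, b-r) equals C(2a,a) * C(2b,b) / C(a+b,a). -/
/-- Binomial coefficient `C(n,k)` for an integer lower index, equal to `0` when `k < 0`. -/
def intChoose (n : ℕ) (k : ℤ) : ℤ := if 0 ≤ k then n.choose k.toNat else 0

open Polynomial in
/-- The middle coefficient of `(1 + X) ^ (2 * a) * (1 - X) ^ (2 * b)`, up to the sign `(-1) ^ b`. -/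
theorem coeff_one_add_X_pow_mul_one_sub_X_pow (a b : ℕ) :
    (-1) ^ b * ((1 + X : ℚ[X]) ^ (2 * a) * (1 - X) ^ (2 * b)).coeff (a + b) =
      ((2 * a).factorial * (2 * b).factorial : ℚ) /
        (a.factorial * b.factorial * (a + b).factorial) := by
  induction b generalizing a with
  | zero =>
    have h := Nat.choose_mul_factorial_mul_factorial (show a ≤ 2 * a by omega)
    rw [show 2 * a - a = a by omega] at h
    have h' : ((2 * a).choose a * a.factorial * a.factorial : ℚ) = (2 * a).factorial := by
      exact_mod_cast h
    have ha : (a.factorial : ℚ) ≠ 0 := by positivity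
    simp only [pow_zero, mul_zero, add_zero, mul_one, one_mul, coeff_one_add_X_pow,
      Nat.factorial_zero, Nat.cast_one]
    rw [← h']
    field_simp
  | succ b ih =>
    have key : (1 + X : ℚ[X]) ^ (2 * a) * (1 - X) ^ (2 * (b + 1)) =
        (1 + X) ^ (2 * (a + 1)) * (1 - X) ^ (2 * b) -
          C 4 * ((1 + X) ^ (2 * a) * (1 - X) ^ (2 * b) * X) := by
      rw [show (C 4 : ℚ[X]) = 4 from rfl]
      ring
    have h1 := ih a
    have h2 := ih (a + 1)
    rw [show a + 1 + b = a + b + 1 by ring] at h2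
    rw [key, ← add_assoc, coeff_sub, coeff_C_mul, coeff_mul_X]
    calc _ = 4 * ((-1 : ℚ) ^ b * ((1 + X : ℚ[X]) ^ (2 * a) * (1 - X) ^ (2 * b)).coeff (a + b)) -
          (-1) ^ b * ((1 + X : ℚ[X]) ^ (2 * (a + 1)) * (1 - X) ^ (2 * b)).coeff (a + b + 1) := by
          ring
      _ = _ := by
          rw [h1, h2]
          simp only [mul_add, mul_one, Nat.factorial_succ, Nat.cast_mul, Nat.cast_add,
            Nat.cast_one, Nat.cast_ofNat]
          field_simp
          ring

open Polynomial in
theorem coeff_one_sub_X_pow_eq (n k : ℕ) :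
    ((1 - X : ℚ[X]) ^ n).coeff k = (-1) ^ k * n.choose k := by
  have h : (1 - X : ℚ[X]) ^ n = ((1 + X) ^ n).comp (C (-1) * X) := by
    simp [sub_eq_add_neg]
  rw [h, comp_C_mul_X_coeff, coeff_one_add_X_pow, mul_comm]

theorem intChoose_natCast (n k : ℕ) : intChoose n (k : ℤ) = n.choose k := by
  simp [intChoose]

/-- Szily's formula. -/
theorem szily_formula (a b : ℕ) (hab : b ≤ a) :
    ∑ r ∈ Finset.Icc (-(b : ℤ)) (b : ℤ),
        ((-1 : ℚ) ^ r * (intChoose (2 * a) ((a : ℤ) - r) : ℚ) *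
          (intChoose (2 * b) ((b : ℤ) - r) : ℚ)) =
      (((2 * a).choose a : ℚ) * ((2 * b).choose b : ℚ)) / ((a + b).choose a : ℚ) := by
  have hsum : ∑ r ∈ Finset.Icc (-(b : ℤ)) (b : ℤ),
        ((-1 : ℚ) ^ r * (intChoose (2 * a) ((a : ℤ) - r) : ℚ) *
          (intChoose (2 * b) ((b : ℤ) - r) : ℚ)) =
      ∑ j ∈ Finset.range (2 * b + 1),
        (-1 : ℚ) ^ b * ((-1) ^ j * (2 * b).choose j * (2 * a).choose (a + b - j)) := by
    refine Finset.sum_nbij' (fun r => (b + r).toNat) (fun j => (j : ℤ) - b) ?_ ?_ ?_ ?_ ?_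
    · intro r hr; simp only [Finset.mem_Icc, Finset.mem_range] at *; omega
    · intro j hj; simp only [Finset.mem_Icc, Finset.mem_range] at *; omega
    · intro r hr; simp only [Finset.mem_Icc] at *; omega
    · intro j hj; simp
    · intro r hr
      rw [Finset.mem_Icc] at hr
      obtain ⟨j, hj⟩ := Int.eq_ofNat_of_zero_le (show 0 ≤ (b : ℤ) + r by omega)
      obtain rfl : r = (j : ℤ) - b := by omega
      have hj2 : j ≤ 2 * b := by omega
      rw [hj, Int.toNat_natCast, show (a : ℤ) - (j - b) = ((a + b - j : ℕ) : ℤ) by omega,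
        show (b : ℤ) - (j - b) = ((2 * b - j : ℕ) : ℤ) by omega, intChoose_natCast,
        intChoose_natCast, Nat.choose_symm hj2, zpow_sub₀ (by norm_num), zpow_natCast,
        zpow_natCast, div_eq_mul_inv, ← inv_pow, inv_neg_one]
      push_cast
      ring
  have hcoeff := coeff_one_add_X_pow_mul_one_sub_X_pow a b
  rw [mul_comm ((1 + Polynomial.X : Polynomial ℚ) ^ _), Polynomial.coeff_mul,
    Finset.Nat.sum_antidiagonal_eq_sum_range_succ_mk] at hcoeff
  simp only [coeff_one_sub_X_pow_eq, Polynomial.coeff_one_add_X_pow] at hcoeff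
  rw [hsum, ← Finset.mul_sum, Finset.sum_subset
    (Finset.range_subset_range.2 (show 2 * b + 1 ≤ (a + b).succ by omega)), hcoeff]
  · rw [Nat.cast_choose ℚ (show a ≤ 2 * a by omega), Nat.cast_choose ℚ (show b ≤ 2 * b by omega),
      Nat.cast_choose ℚ (show a ≤ a + b by omega), show 2 * a - a = a by omega,
      show 2 * b - b = b by omega, Nat.add_sub_cancel_left]
    field_simp
  · intro j _ hj
    rw [Nat.choose_eq_zero_of_lt (by simpa using hj)]
    simp
end

section
/- Let ψ(z) = ∑_{k=0}^{n} a_k z^k = ∏_{k=1}^{n} (1 + ρ_k z) with all ρ_k > 0 (so ψ is a real polynomial with all zeros real and negative), and set a_k = 0 for k outside {0,...,n}. Fix a positive integer p. Then the polynomial ∑_{k=0}^{n} L_k^p z^k, where L_k^p := C(2p-1,p) a_k^2 + ∑_{j=1}^{p} (-1)^j C(2p,p-j) a_{k-j} a_{k+j}, has all zeros real and negative. -/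
open Polynomial
open scoped LaurentPolynomial

theorem norm_two_mul_re_mul_inv_sub_one_le {x ζ : ℂ} (hx : 0 < x.re) (hζ : ζ.re ≤ 0) :
    ‖2 * (x.re : ℂ) * (1 / (x - ζ)) - 1‖ ≤ 1 := by
  have hne : x - ζ ≠ 0 := fun h => by
    have := congrArg Complex.re h
    simp at this
    linarith
  have : 2 * (x.re : ℂ) * (1 / (x - ζ)) - 1 = (2 * x.re - (x - ζ)) / (x - ζ) := by
    field_simp
  rw [this, norm_div, div_le_one (norm_pos_iff.2 hne)]
  rw [← sq_le_sq₀ (norm_nonneg _) (norm_nonneg _), Complex.sq_norm, Complex.sq_norm,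
    Complex.normSq_apply, Complex.normSq_apply]
  simp
  nlinarith

theorem norm_multiset_sum_sub_card_le (s : Multiset ℂ) (h : ∀ v ∈ s, ‖v - 1‖ ≤ 1) :
    ‖s.sum - s.card‖ ≤ s.card := by
  induction s using Multiset.induction_on with
  | empty => simp
  | cons v s ih =>
    have h1 := h v (by simp)
    have h2 := ih fun w hw => h w (by simp [hw])
    have : (v ::ₘ s).sum - ((v ::ₘ s).card : ℂ) = (s.sum - s.card) + (v - 1) := by
      simp; ring
    rw [this]
    refine (norm_add_le _ _).trans ?_
    simp
    linarith

/-- Laguerre's theorem on polar derivatives, for the right half-plane. -/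
theorem laguerre_polar_derivative_ne_zero {G : ℂ[X]} {m : ℕ} (hm : 0 < m)
    (hdeg : G.natDegree ≤ m) (hG : ∀ x : ℂ, 0 < x.re → G.eval x ≠ 0) {x κ : ℂ}
    (hx : 0 < x.re) (hκ : 0 < κ.re) :
    (m : ℂ) * G.eval x ≠ (x - κ) * G.derivative.eval x := by
  intro heq
  have hGx := hG x hx
  have hlog := (IsAlgClosed.splits G).eval_derivative_div_eval_of_ne_zero hGx
  set V := G.derivative.eval x / G.eval x with hV
  have hmV : (m : ℂ) = (x - κ) * V := by
    rw [hV]; field_simp; exact heq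
  have hroots := norm_multiset_sum_sub_card_le
    (G.roots.map fun ζ => 2 * (x.re : ℂ) * (1 / (x - ζ))) (by
      intro v hv
      obtain ⟨ζ, hζ, rfl⟩ := Multiset.mem_map.1 hv
      refine norm_two_mul_re_mul_inv_sub_one_le hx (not_lt.1 fun h => hG ζ h ?_)
      exact (Polynomial.mem_roots'.1 hζ).2)
  rw [Multiset.sum_map_mul_left, ← hlog, Multiset.card_map] at hroots
  have hd : G.roots.card ≤ m := (Polynomial.card_roots' G).trans hdeg
  have hle : ‖2 * (x.re : ℂ) * V - m‖ ≤ m := by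
    have : 2 * (x.re : ℂ) * V - m = (2 * x.re * V - G.roots.card) - ((m - G.roots.card : ℕ) : ℂ) := by
      push_cast [hd]; ring
    rw [this]
    refine (norm_sub_le _ _).trans ?_
    rw [Complex.norm_natCast]
    push_cast [hd]
    linarith
  have hm' : (0 : ℝ) < m := by exact_mod_cast hm
  have hV0 : V ≠ 0 := fun h => by
    rw [h, mul_zero] at hmV
    exact hm.ne' (by exact_mod_cast hmV)
  rw [hmV, ← sub_mul, norm_mul] at hle
  have hnm : (m : ℝ) = ‖x - κ‖ * ‖V‖ := by
    rw [← norm_mul, ← hmV, Complex.norm_natCast]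
  rw [hnm] at hle
  have h3 := le_of_mul_le_mul_right hle (norm_pos_iff.2 hV0)
  rw [← sq_le_sq₀ (norm_nonneg _) (norm_nonneg _), Complex.sq_norm, Complex.sq_norm,
    Complex.normSq_apply, Complex.normSq_apply] at h3
  simp at h3
  nlinarith [mul_pos hx hκ]

/-- Varying one of the coinciding factors keeps the functional nonzero. -/
theorem functional_mul_X_add_C_ne_zero (Λ : ℂ[X] →ₗ[ℂ] ℂ) (q : ℂ[X]) (k : ℕ)
    (h : ∀ x : ℂ, 0 < x.re → Λ ((X + C x) ^ (k + 1) * q) ≠ 0) {x κ : ℂ}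
    (hx : 0 < x.re) (hκ : 0 < κ.re) :
    Λ ((X + C x) ^ k * ((X + C κ) * q)) ≠ 0 := by
  let F : ℕ → ℂ[X] := fun k => ∑ i ∈ Finset.range (k + 1),
    C (Λ (X ^ (k - i) * q) * (k.choose i : ℂ)) * X ^ i
  have hF : ∀ k x, (F k).eval x = Λ ((X + C x) ^ k * q) := by
    intro k x
    rw [add_comm X, add_pow, Finset.sum_mul, map_sum]
    simp only [F, eval_finsetSum]
    refine Finset.sum_congr rfl fun i _ => ?_
    have : C x ^ i * X ^ (k - i) * (k.choose i : ℂ[X]) * q =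
        (x ^ i * (k.choose i : ℂ)) • (X ^ (k - i) * q) := by
      rw [smul_eq_C_mul]; simp; ring
    rw [this, map_smul]
    simp
    ring
  have hdeg : (F (k + 1)).natDegree ≤ k + 1 := by
    refine natDegree_sum_le_of_forall_le _ _ fun i hi => ?_
    exact (natDegree_C_mul_X_pow_le _ _).trans (Finset.mem_range_succ_iff.1 hi)
  have hder : (F (k + 1)).derivative = C ((k : ℂ) + 1) * F k := by
    dsimp only [F]
    rw [Finset.sum_range_succ']
    simp only [derivative_add, derivative_sum, Finset.mul_sum, derivative_C_mul_X_pow]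
    rw [Nat.cast_zero, mul_zero, map_zero, zero_mul, add_zero]
    refine Finset.sum_congr rfl fun i _ => ?_
    rw [← mul_assoc, ← C_mul]
    congr 2
    have := Nat.add_one_mul_choose_eq k i
    have h2 : ((k : ℂ) + 1) * k.choose i = (k + 1).choose (i + 1) * (i + 1) := by
      exact_mod_cast this
    simp only [Nat.add_sub_add_right]
    push_cast
    linear_combination -Λ (X ^ (k - i) * q) * h2
  have key := laguerre_polar_derivative_ne_zero (Nat.succ_pos k) hdeg
    (fun x hx => by rw [hF]; exact h x hx) hx hκ
  rw [hder, eval_mul, eval_C, hF, hF] at key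
  intro h0
  apply key
  have : (X + C x) ^ (k + 1) * q = (X + C x) ^ k * ((X + C κ) * q) +
      (x - κ) • ((X + C x) ^ k * q) := by
    rw [smul_eq_C_mul, C_sub]; ring
  rw [this, map_add, h0, map_smul, smul_eq_mul]
  push_cast
  ring

/-- A form of the Grace–Walsh–Szegő theorem for the right half-plane. -/
theorem functional_prod_X_add_C_ne_zero (Λ : ℂ[X] →ₗ[ℂ] ℂ) (s : Multiset ℂ)
    (hs : ∀ κ ∈ s, 0 < κ.re)
    (h : ∀ x : ℂ, 0 < x.re → Λ ((X + C x) ^ s.card) ≠ 0) :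
    Λ (s.map fun κ => X + C κ).prod ≠ 0 := by
  have gen : ∀ (s : Multiset ℂ), (∀ κ ∈ s, 0 < κ.re) → ∀ k : ℕ,
      (∀ x : ℂ, 0 < x.re → Λ ((X + C x) ^ (s.card + k)) ≠ 0) →
      ∀ x : ℂ, 0 < x.re → Λ ((X + C x) ^ k * (s.map fun κ => X + C κ).prod) ≠ 0 := by
    intro s
    induction s using Multiset.induction_on with
    | empty => intro _ k hk x hx; simpa using hk x hx
    | cons κ s ih =>
      intro hs k hk x hx
      rw [Multiset.map_cons, Multiset.prod_cons]
      refine functional_mul_X_add_C_ne_zero Λ _ k ?_ hx (hs κ (by simp))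
      refine ih (fun w hw => hs w (by simp [hw])) (k + 1) ?_
      simpa [add_assoc, add_comm 1 k] using hk
  simpa using gen s hs 0 (by simpa using h) 1 (by simp)

theorem mem_of_eval_iterate_derivative_eq_zero {K : Set ℂ} (hK : Convex ℝ K) (k : ℕ) :
    ∀ {f : ℂ[X]}, k ≤ f.natDegree → f ≠ 0 → (∀ z, f.eval z = 0 → z ∈ K) →
      ∀ z, (derivative^[k] f).eval z = 0 → z ∈ K := by
  induction k with
  | zero => intro f _ _ h z hz; exact h z hz
  | succ k ih =>
    intro f hk hf h z hz
    rw [Function.iterate_succ_apply] at hz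
    have hdeg : f.derivative.natDegree = f.natDegree - 1 := natDegree_derivative f
    have hpos : 0 < f.natDegree := by omega
    have hf' : f.derivative ≠ 0 := fun h0 => by
      have := derivative_eq_zero.1 h0
      omega
    refine ih (f := f.derivative) (by omega) hf' (fun w hw => ?_) z hz
    have hmem := rootSet_derivative_subset_convexHull_rootSet (P := f)
      (natDegree_pos_iff_degree_pos.1 hpos)
      ((mem_rootSet_of_ne hf').2 (by simpa [coe_aeval_eq_eval] using hw))
    refine convexHull_min (fun v hv => h v ?_) hK hmem
    simpa [coe_aeval_eq_eval] using ((mem_rootSet_of_ne hf).1 hv)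

theorem exists_ofReal_of_eval_iterate_derivative_eq_zero {N k : ℕ} (hk : k ≤ 2 * N) {z : ℂ}
    (hz : (derivative^[k] ((X ^ 2 - 1 : ℂ[X]) ^ N)).eval z = 0) :
    ∃ t : ℝ, t ^ 2 ≤ 1 ∧ z = t := by
  have hdeg : (X ^ 2 - 1 : ℂ[X]).natDegree = 2 := by compute_degree!
  have hne : (X ^ 2 - 1 : ℂ[X]) ≠ 0 := fun h => by simp [h] at hdeg
  have hmem := mem_of_eval_iterate_derivative_eq_zero (convex_segment (𝕜 := ℝ) (-1 : ℂ) 1) k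
    (by rw [natDegree_pow, hdeg]; omega) (pow_ne_zero N hne) (fun w hw => by
      have hw' : w ^ 2 - 1 = 0 := by simpa using eq_zero_of_pow_eq_zero (by simpa using hw)
      rcases sq_eq_sq_iff_eq_or_eq_neg.1 ((sub_eq_zero.1 hw').trans (one_pow 2).symm) with rfl | rfl
      · exact right_mem_segment _ _ _
      · exact left_mem_segment _ _ _) z hz
  obtain ⟨a, b, ha, hb, hab, rfl⟩ := hmem
  refine ⟨b - a, by nlinarith, ?_⟩
  simp
  ring

theorem coeff_trinomial_pow_ne_zero {N k : ℕ} (hk : k ≤ 2 * N) {κ : ℂ} (hκ : 0 < κ.re) :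
    ((X ^ 2 + C κ * X + 1 : ℂ[X]) ^ N).coeff k ≠ 0 := by
  by_cases h4 : κ ^ 2 - 4 = 0
  · have h2 : κ = 2 := by
      have : (κ - 2) * (κ + 2) = 0 := by linear_combination h4
      rcases mul_eq_zero.1 this with h | h
      · exact sub_eq_zero.1 h
      · have := congrArg Complex.re h
        simp at this
        linarith
    have : (X ^ 2 + C κ * X + 1 : ℂ[X]) = (X + 1) ^ 2 := by
      rw [h2, show (C (2 : ℂ)) = 2 from rfl]; ring
    rw [this, ← pow_mul, coeff_X_add_one_pow]
    exact_mod_cast (Nat.choose_pos hk).ne'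
  · obtain ⟨D, hD⟩ := IsAlgClosed.exists_pow_nat_eq (κ ^ 2 - 4) two_pos
    have hD0 : D ≠ 0 := fun h => h4 (by rw [← hD, h]; simp)
    intro h0
    have hcomp : (taylor (κ / D) ((X ^ 2 - 1 : ℂ[X]) ^ N)).comp (C (2 / D) * X) =
        C ((2 / D) ^ (2 * N)) * (X ^ 2 + C κ * X + 1 : ℂ[X]) ^ N := by
      rw [taylor_apply, pow_mul (2 / D), map_pow, ← mul_pow]
      simp only [pow_comp, sub_comp, X_comp, one_comp, add_comp, C_comp]
      congr 1
      have e1 : C (κ / D) ^ 2 - 1 = (C ((2 / D) ^ 2) : ℂ[X]) := by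
        rw [← C_pow, ← C_1, ← C_sub]
        congr 1
        field_simp
        rw [hD]; ring
      have e2 : (2 * C (2 / D) * C (κ / D) : ℂ[X]) = C ((2 / D) ^ 2) * C κ := by
        rw [show (2 : ℂ[X]) = C 2 from rfl, ← C_mul, ← C_mul, ← C_mul]
        congr 1
        field_simp
      have e3 : (C (2 / D) ^ 2 : ℂ[X]) = C ((2 / D) ^ 2) := (map_pow _ _ _).symm
      linear_combination e1 + X * e2 + X ^ 2 * e3
    have hc := congrArg (fun f => coeff f k) hcomp
    simp only [comp_C_mul_X_coeff, coeff_C_mul, h0, mul_zero, taylor_coeff] at hc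
    have hev : (hasseDeriv k ((X ^ 2 - 1 : ℂ[X]) ^ N)).eval (κ / D) = 0 :=
      (mul_eq_zero.1 hc).resolve_right (pow_ne_zero _ (div_ne_zero two_ne_zero hD0))
    obtain ⟨t, ht, htz⟩ := exists_ofReal_of_eval_iterate_derivative_eq_zero hk (z := κ / D) (by
      have := congrFun (factorial_smul_hasseDeriv (R := ℂ) k) ((X ^ 2 - 1 : ℂ[X]) ^ N)
      rw [← this]
      simp [hev])
    have hκD : κ = t * D := by rw [← htz]; field_simp
    have hsq : κ ^ 2 * (1 - t ^ 2 : ℝ) = (-4 * t ^ 2 : ℝ) := by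
      push_cast
      have : κ ^ 2 = t ^ 2 * (κ ^ 2 - 4) := by rw [← hD, hκD]; ring
      linear_combination this
    have hre := congrArg Complex.re hsq
    have him := congrArg Complex.im hsq
    rw [Complex.re_mul_ofReal, Complex.ofReal_re, pow_two, Complex.mul_re] at hre
    rw [Complex.im_mul_ofReal, Complex.ofReal_im, pow_two, Complex.mul_im] at him
    rcases eq_or_lt_of_le ht with h1 | h1
    · rw [h1] at hre; norm_num at hre
    · have him' : κ.im = 0 := by
        rcases mul_eq_zero.1 him with h | h
        · nlinarith
        · linarith
      rw [him'] at hre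
      have := mul_pos (mul_pos hκ hκ) (sub_pos.2 h1)
      nlinarith [sq_nonneg t]

/-- The constant coefficient of `(T - T⁻¹) ^ (2 * p) * f`. -/
noncomputable def constCoeffWeighted (p : ℕ) : ℂ[T;T⁻¹] →ₗ[ℂ] ℂ where
  toFun f := ((LaurentPolynomial.T 1 - LaurentPolynomial.T (-1)) ^ (2 * p) * f).coeff 0
  map_add' f g := by simp [mul_add]
  map_smul' c f := by simp

/-- The functional `f ↦ constCoeffWeighted p (f (T + T⁻¹))`. -/
noncomputable def symFunctional (p : ℕ) : ℂ[X] →ₗ[ℂ] ℂ :=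
  constCoeffWeighted p ∘ₗ
    (aeval (LaurentPolynomial.T 1 + LaurentPolynomial.T (-1) : ℂ[T;T⁻¹])).toLinearMap

theorem symFunctional_apply (p : ℕ) (f : ℂ[X]) : symFunctional p f =
    constCoeffWeighted p (aeval (LaurentPolynomial.T 1 + LaurentPolynomial.T (-1)) f) := rfl

theorem constCoeffWeighted_T (p : ℕ) (j : ℤ) :
    constCoeffWeighted p (LaurentPolynomial.T j) =
      ∑ r ∈ Finset.range (2 * p + 1),
        if 2 * (r : ℤ) - 2 * p + j = 0 then (-1 : ℂ) ^ r * ((2 * p).choose r : ℂ) else 0 := by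
  change ((_ : ℂ[T;T⁻¹]) ^ (2 * p) * _).coeff 0 = _
  rw [sub_eq_add_neg, add_pow, Finset.sum_mul, AddMonoidAlgebra.coeff_sum, Finset.sum_apply']
  refine Finset.sum_congr rfl fun r hr => ?_
  have hr' : r ≤ 2 * p := Finset.mem_range_succ_iff.1 hr
  have hs : (-1 : ℂ) ^ (2 * p - r) = (-1) ^ r :=
    neg_one_pow_congr (by grind)
  have : (LaurentPolynomial.T 1 ^ r * (-LaurentPolynomial.T (-1)) ^ (2 * p - r) *
      ((2 * p).choose r : ℂ[T;T⁻¹]) * LaurentPolynomial.T j) =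
      ((-1 : ℂ) ^ r * ((2 * p).choose r : ℂ)) • LaurentPolynomial.T (2 * (r : ℤ) - 2 * p + j) := by
    rw [neg_pow, LaurentPolynomial.T_pow, LaurentPolynomial.T_pow, ← hs,
      LaurentPolynomial.smul_eq_C_mul]
    have e : 2 * (r : ℤ) - 2 * p + j = (r * 1) + ((2 * p - r : ℕ) * (-1)) + j := by
      push_cast [hr']; ring
    rw [e, LaurentPolynomial.T_add, LaurentPolynomial.T_add]
    simp only [map_mul, map_pow, map_neg, map_one, map_natCast]
    ring
  rw [this]
  simp

theorem symFunctional_succ_X_pow (p m : ℕ) :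
    symFunctional (p + 1) (X ^ m) =
      symFunctional p (X ^ (m + 2)) - 4 * symFunctional p (X ^ m) := by
  have hT : (LaurentPolynomial.T 1 * LaurentPolynomial.T (-1) : ℂ[T;T⁻¹]) = 1 := by
    rw [← LaurentPolynomial.T_add]; simp
  rw [← smul_eq_mul, ← map_smul, ← map_sub, symFunctional_apply, symFunctional_apply]
  change (_ : ℂ[T;T⁻¹]).coeff 0 = (_ : ℂ[T;T⁻¹]).coeff 0
  refine congrArg (fun f : ℂ[T;T⁻¹] => f.coeff 0) ?_
  rw [smul_eq_C_mul]
  simp only [map_sub, map_mul, map_pow, aeval_X, map_ofNat]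
  generalize (LaurentPolynomial.T 1 : ℂ[T;T⁻¹]) = u at *
  generalize (LaurentPolynomial.T (-1) : ℂ[T;T⁻¹]) = v at *
  rw [show 2 * (p + 1) = 2 * p + 2 by ring, pow_add _ (2 * p) 2, pow_add _ m 2]
  linear_combination (-4 * (u - v) ^ (2 * p) * (u + v) ^ m) * hT

theorem symFunctional_zero_X_pow (m : ℕ) :
    symFunctional 0 (X ^ m) = if 2 ∣ m then (m.choose (m / 2) : ℂ) else 0 := by
  rw [symFunctional_apply, map_pow, aeval_X]
  change ((_ : ℂ[T;T⁻¹]) ^ (2 * 0) * _).coeff 0 = _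
  rw [mul_zero, pow_zero, one_mul, add_pow, AddMonoidAlgebra.coeff_sum, Finset.sum_apply']
  have : ∀ r ∈ Finset.range (m + 1), (LaurentPolynomial.T 1 ^ r *
      LaurentPolynomial.T (-1) ^ (m - r) * ((m.choose r : ℕ) : ℂ[T;T⁻¹])).coeff 0 =
      if 2 * r = m then (m.choose r : ℂ) else 0 := by
    intro r hr
    have hr' : r ≤ m := Finset.mem_range_succ_iff.1 hr
    rw [LaurentPolynomial.T_pow, LaurentPolynomial.T_pow, ← LaurentPolynomial.T_add, mul_comm,
      ← map_natCast (LaurentPolynomial.C (R := ℂ)), ← LaurentPolynomial.smul_eq_C_mul]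
    have e : ((r * 1 + (m - r : ℕ) * (-1) : ℤ) = 0) ↔ 2 * r = m := by omega
    simp only [AddMonoidAlgebra.coeff_smul, Finsupp.smul_apply, LaurentPolynomial.T_apply, e]
    simp
  rw [Finset.sum_congr rfl this]
  split_ifs with h
  · obtain ⟨i, rfl⟩ := h
    rw [Finset.sum_eq_single i]
    · simp
    · intro b _ hb; rw [if_neg (by omega)]
    · intro hi; exact absurd (Finset.mem_range.2 (by omega)) hi
  · exact Finset.sum_eq_zero fun r _ => if_neg fun e => h ⟨r, e.symm⟩

theorem symFunctional_X_pow_of_not_dvd (p : ℕ) : ∀ {m : ℕ}, ¬ 2 ∣ m →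
    symFunctional p (X ^ m) = 0 := by
  induction p with
  | zero => intro m hm; rw [symFunctional_zero_X_pow, if_neg hm]
  | succ p ih =>
    intro m hm
    rw [symFunctional_succ_X_pow, ih hm, ih (by omega)]
    simp

theorem symFunctional_X_pow_even (p : ℕ) : ∀ i : ℕ,
    symFunctional p (X ^ (2 * i)) =
      (-1) ^ p * ((2 * p).factorial * (2 * i).factorial : ℂ) /
        (p.factorial * i.factorial * (p + i).factorial) := by
  induction p with
  | zero =>
    intro i
    rw [symFunctional_zero_X_pow, if_pos (Dvd.intro _ rfl), Nat.mul_div_cancel_left _ two_pos,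
      Nat.cast_choose ℂ (by omega : i ≤ 2 * i), show 2 * i - i = i by omega]
    simp
  | succ p ih =>
    intro i
    have h1 : ∀ k : ℕ, (k.factorial : ℂ) ≠ 0 := fun k => by exact_mod_cast k.factorial_ne_zero
    rw [symFunctional_succ_X_pow, show 2 * i + 2 = 2 * (i + 1) by ring, ih, ih,
      show 2 * (i + 1) = 2 * i + 1 + 1 by ring, show 2 * (p + 1) = 2 * p + 1 + 1 by ring,
      show p + (i + 1) = p + i + 1 by ring, show p + 1 + i = p + i + 1 by ring]
    simp only [Nat.factorial_succ, Nat.cast_mul]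
    have := h1 p
    have := h1 i
    have := h1 (p + i)
    have h2 : ((p + 1 : ℕ) : ℂ) ≠ 0 := by exact_mod_cast p.succ_ne_zero
    have h3 : ((i + 1 : ℕ) : ℂ) ≠ 0 := by exact_mod_cast i.succ_ne_zero
    have h4 : ((p + i + 1 : ℕ) : ℂ) ≠ 0 := by exact_mod_cast (p + i).succ_ne_zero
    field_simp
    push_cast
    ring

theorem coeff_X_sq_add_one_pow (M k : ℕ) :
    ((X ^ 2 + 1 : ℂ[X]) ^ M).coeff k = if 2 ∣ k then (M.choose (k / 2) : ℂ) else 0 := by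
  have : (X ^ 2 + 1 : ℂ[X]) ^ M = expand ℂ 2 ((X + 1) ^ M) := by simp
  rw [this, coeff_expand two_pos, coeff_X_add_one_pow]

theorem coeff_trinomial_pow (n p : ℕ) (κ : ℂ) :
    ((X ^ 2 + C κ * X + 1 : ℂ[X]) ^ (n + p)).coeff (n + 2 * p) =
      ∑ m ∈ Finset.range (n + 1), κ ^ (n - m) * ((n + p).choose (n - m) : ℂ) *
        if 2 ∣ m then ((p + m).choose (p + m / 2) : ℂ) else 0 := by
  have hterm : ∀ i, i ≤ n + p → ((C κ * X) ^ i * (X ^ 2 + 1) ^ (n + p - i) *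
      ((n + p).choose i : ℂ[X])).coeff (n + 2 * p) = κ ^ i * ((n + p).choose i : ℂ) *
        ((X ^ 2 + 1 : ℂ[X]) ^ (n + p - i)).coeff (n + 2 * p - i) := by
    intro i hi
    have : ((C κ * X) ^ i * (X ^ 2 + 1) ^ (n + p - i) * ((n + p).choose i : ℂ[X])) =
        C (κ ^ i * ((n + p).choose i : ℂ)) * ((X ^ 2 + 1) ^ (n + p - i) * X ^ i) := by
      simp; ring
    rw [this, coeff_C_mul, coeff_mul_X_pow', if_pos (by omega)]
  rw [show (X ^ 2 + C κ * X + 1 : ℂ[X]) = C κ * X + (X ^ 2 + 1) by ring, add_pow,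
    finsetSum_coeff, show n + p + 1 = (n + 1) + p by ring, Finset.sum_range_add]
  rw [Finset.sum_eq_zero (s := Finset.range p), add_zero, ← Finset.sum_range_reflect]
  · refine Finset.sum_congr rfl fun m hm => ?_
    have hm' : m ≤ n := Finset.mem_range_succ_iff.1 hm
    rw [show n + 1 - 1 - m = n - m by omega, hterm _ (by omega), coeff_X_sq_add_one_pow,
      show n + p - (n - m) = p + m by omega, show n + 2 * p - (n - m) = 2 * p + m by omega]
    congr 1
    by_cases h : 2 ∣ m
    · rw [if_pos h, if_pos (by omega), show (2 * p + m) / 2 = p + m / 2 by omega]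
    · rw [if_neg h, if_neg (by omega)]
  · intro i hi
    have := Finset.mem_range.1 hi
    rw [hterm _ (by omega), coeff_X_sq_add_one_pow]
    split_ifs with h
    · have hlt : n + p - (n + 1 + i) < (n + 2 * p - (n + 1 + i)) / 2 := by
        rw [show n + 2 * p - (n + 1 + i) = 2 * p - 1 - i by omega]
        omega
      rw [Nat.choose_eq_zero_of_lt hlt]; simp
    · simp

theorem symFunctional_X_add_C_pow (n p : ℕ) (κ : ℂ) :
    ((n + p).factorial * p.factorial : ℂ) * symFunctional p ((X + C κ) ^ n) =
      (-1) ^ p * (n.factorial * (2 * p).factorial : ℂ) *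
        ((X ^ 2 + C κ * X + 1 : ℂ[X]) ^ (n + p)).coeff (n + 2 * p) := by
  have h1 : ∀ k : ℕ, (k.factorial : ℂ) ≠ 0 := fun k => by exact_mod_cast k.factorial_ne_zero
  rw [coeff_trinomial_pow, add_pow, map_sum, Finset.mul_sum, Finset.mul_sum]
  refine Finset.sum_congr rfl fun m hm => ?_
  have hm' : m ≤ n := Finset.mem_range_succ_iff.1 hm
  have : (X ^ m * C κ ^ (n - m) * (n.choose m : ℂ[X])) =
      (κ ^ (n - m) * (n.choose m : ℂ)) • X ^ m := by
    rw [smul_eq_C_mul]; simp; ring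
  rw [this, map_smul, smul_eq_mul]
  split_ifs with h
  · obtain ⟨i, rfl⟩ := h
    rw [symFunctional_X_pow_even, Nat.mul_div_cancel_left _ two_pos, Nat.cast_choose ℂ hm',
      Nat.cast_choose ℂ (by omega : n - 2 * i ≤ n + p),
      Nat.cast_choose ℂ (by omega : p + i ≤ p + 2 * i),
      show n + p - (n - 2 * i) = p + 2 * i by omega, show p + 2 * i - (p + i) = i by omega]
    have := h1 p
    have := h1 i
    have := h1 (p + i)
    have := h1 (p + 2 * i)
    have := h1 (2 * i)
    have := h1 (n - 2 * i)
    field_simp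
  · rw [symFunctional_X_pow_of_not_dvd p h]; simp

theorem symFunctional_X_add_C_pow_ne_zero (n p : ℕ) {κ : ℂ} (hκ : 0 < κ.re) :
    symFunctional p ((X + C κ) ^ n) ≠ 0 := by
  have h1 : ∀ k : ℕ, (k.factorial : ℂ) ≠ 0 := fun k => by exact_mod_cast k.factorial_ne_zero
  intro h
  have := symFunctional_X_add_C_pow n p κ
  rw [h, mul_zero] at this
  refine mul_ne_zero (mul_ne_zero (pow_ne_zero p (neg_ne_zero.2 one_ne_zero))
    (mul_ne_zero (h1 n) (h1 (2 * p)))) (coeff_trinomial_pow_ne_zero ?_ hκ) this.symm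
  omega

theorem sum_sum_ite_eq_sum_symm {n : ℕ} {a : ℤ → ℂ}
    (ha : ∀ k : ℤ, (k < 0 ∨ (n : ℤ) < k) → a k = 0) (t : ℂ) (j : ℤ) :
    ∑ m ∈ Finset.range (n + 1), ∑ l ∈ Finset.range (n + 1),
      (if 2 * j + (m - l) = 0 then a m * a l * t ^ (m + l) else 0) =
    ∑ k ∈ Finset.range (n + 1), a (k - j) * a (k + j) * (t ^ 2) ^ k := by
  rw [← Finset.sum_product', ← Finset.sum_filter]
  rw [← Finset.sum_filter_of_ne (s := Finset.range (n + 1))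
    (p := fun k : ℕ => 0 ≤ (k : ℤ) - j ∧ (k : ℤ) - j ≤ n ∧ 0 ≤ (k : ℤ) + j ∧ (k : ℤ) + j ≤ n)]
  · refine Finset.sum_nbij' (fun x => ((x.1 : ℤ) + j).toNat)
      (fun k => (((k : ℤ) - j).toNat, ((k : ℤ) + j).toNat)) ?_ ?_ ?_ ?_ ?_
    · rintro ⟨m, l⟩ h
      simp only [Finset.mem_filter, Finset.mem_product, Finset.mem_range] at h ⊢
      omega
    · intro k h
      simp only [Finset.mem_filter, Finset.mem_product, Finset.mem_range] at h ⊢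
      omega
    · rintro ⟨m, l⟩ h
      simp only [Finset.mem_filter, Finset.mem_product, Finset.mem_range] at h
      simp only [Prod.mk.injEq]
      omega
    · intro k h
      simp only [Finset.mem_filter, Finset.mem_range] at h
      simp only
      omega
    · rintro ⟨m, l⟩ h
      simp only [Finset.mem_filter, Finset.mem_product, Finset.mem_range] at h
      simp only
      have hk : ((((m : ℤ) + j).toNat : ℕ) : ℤ) = m + j := by omega
      rw [hk, ← pow_mul, show 2 * ((m : ℤ) + j).toNat = m + l by omega,
        show (m : ℤ) + j - j = m by ring, show (m : ℤ) + j + j = l by omega]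
  · intro k _ hk
    by_contra hcon
    apply hk
    by_cases h : (k : ℤ) - j < 0 ∨ (n : ℤ) < k - j
    · rw [ha _ h]; simp
    · rw [ha (k + j) (by omega)]; simp

theorem sum_alternating_choose_of_even {H : ℤ → ℂ} (hH : ∀ j, H (-j) = H j) {p : ℕ} (hp : 0 < p) :
    ∑ r ∈ Finset.range (2 * p + 1), (-1 : ℂ) ^ r * ((2 * p).choose r : ℂ) * H (r - p) =
      2 * (-1) ^ p * (((2 * p - 1).choose p : ℂ) * H 0 +
        ∑ j ∈ Finset.Icc 1 p, (-1 : ℂ) ^ j * ((2 * p).choose (p - j) : ℂ) * H j) := by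
  have hc : ((2 * p).choose p : ℂ) = 2 * ((2 * p - 1).choose p : ℂ) := by
    obtain ⟨q, rfl⟩ : ∃ q, p = q + 1 := ⟨p - 1, by omega⟩
    have h1 := Nat.choose_succ_succ (2 * q + 1) q
    have h2 := Nat.choose_symm_half q
    rw [show 2 * (q + 1) = (2 * q + 1) + 1 by ring, show 2 * q + 1 + 1 - 1 = 2 * q + 1 by omega]
    have : (2 * q + 1 + 1).choose (q + 1) = 2 * (2 * q + 1).choose (q + 1) := by
      simp only [Nat.succ_eq_add_one] at h1
      omega
    exact_mod_cast this
  have hIcc : Finset.Icc 1 p = Finset.Ico 1 (p + 1) := rfl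
  rw [show 2 * p + 1 = p + (p + 1) by ring, Finset.sum_range_add, Finset.sum_range_succ' _ p,
    ← Finset.sum_range_reflect, hIcc, Finset.sum_Ico_eq_sum_range, Nat.add_sub_cancel, mul_add,
    Finset.mul_sum]
  have e0 : (-1 : ℂ) ^ (p + 0) * ((2 * p).choose (p + 0) : ℂ) * H ((p + 0 : ℕ) - p) =
      2 * (-1) ^ p * (((2 * p - 1).choose p : ℂ) * H 0) := by
    simp [hc]; ring
  have e1 : ∀ i ∈ Finset.range p, (-1 : ℂ) ^ (p - 1 - i) * ((2 * p).choose (p - 1 - i) : ℂ) *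
      H ((p - 1 - i : ℕ) - p) =
      (-1) ^ p * ((-1 : ℂ) ^ (1 + i) * ((2 * p).choose (p - (1 + i)) : ℂ) * H (1 + i : ℕ)) := by
    intro i hi
    have := Finset.mem_range.1 hi
    rw [show ((p - 1 - i : ℕ) : ℤ) - p = -((1 + i : ℕ) : ℤ) by omega, hH,
      show p - 1 - i = p - (1 + i) by omega, ← mul_assoc, ← mul_assoc, ← pow_add]
    congr 2
    exact neg_one_pow_congr (by grind)
  have e2 : ∀ i ∈ Finset.range p, (-1 : ℂ) ^ (p + (i + 1)) * ((2 * p).choose (p + (i + 1)) : ℂ) *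
      H ((p + (i + 1) : ℕ) - p) =
      (-1) ^ p * ((-1 : ℂ) ^ (1 + i) * ((2 * p).choose (p - (1 + i)) : ℂ) * H (1 + i : ℕ)) := by
    intro i hi
    have := Finset.mem_range.1 hi
    rw [show ((p + (i + 1) : ℕ) : ℤ) - p = ((1 + i : ℕ) : ℤ) by omega,
      Nat.choose_symm_of_eq_add (show 2 * p = (p + (i + 1)) + (p - (1 + i)) by omega)]
    ring
  rw [Finset.sum_congr rfl e1, Finset.sum_congr rfl e2, e0, add_comm (Finset.sum _ _) (_ * _),
    add_left_comm, ← Finset.sum_add_distrib]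
  congr 1
  exact Finset.sum_congr rfl fun i _ => by ring

theorem prod_eq_sum_of_eval {n : ℕ} {a : ℤ → ℝ} {ρ : Fin n → ℝ}
    (hψ : ∀ z : ℂ, ∑ k ∈ Finset.range (n + 1), (a (k : ℤ) : ℂ) * z ^ k =
        ∏ i, (1 + (ρ i : ℂ) * z)) {A : Type*} [CommRing A] [Algebra ℂ A] (x : A) :
    ∏ i, (1 + algebraMap ℂ A (ρ i) * x) =
      ∑ k ∈ Finset.range (n + 1), algebraMap ℂ A (a (k : ℤ)) * x ^ k := by
  have : (∏ i, (1 + C (ρ i : ℂ) * X) : ℂ[X]) =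
      ∑ k ∈ Finset.range (n + 1), C (a (k : ℤ) : ℂ) * X ^ k := by
    refine Polynomial.funext fun z => ?_
    rw [eval_prod, eval_finsetSum]
    simpa using (hψ z).symm
  simpa using congrArg (aeval x) this

theorem symFunctional_prod {n p : ℕ} {a : ℤ → ℝ} {ρ : Fin n → ℝ} (hp : 0 < p)
    (ha : ∀ k : ℤ, (k < 0 ∨ (n : ℤ) < k) → a k = 0)
    (hψ : ∀ z : ℂ, ∑ k ∈ Finset.range (n + 1), (a (k : ℤ) : ℂ) * z ^ k =
        ∏ i, (1 + (ρ i : ℂ) * z)) (t : ℂ) :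
    symFunctional p (∏ i, (C (1 + (ρ i * t) ^ 2) + C (ρ i * t) * X)) =
      2 * (-1) ^ p * ∑ k ∈ Finset.range (n + 1),
          ((((2 * p - 1).choose p : ℝ) * (a (k : ℤ)) ^ 2 +
            ∑ j ∈ Finset.Icc 1 p,
              (-1 : ℝ) ^ j * ((2 * p).choose (p - j) : ℝ) *
                a ((k : ℤ) - j) * a ((k : ℤ) + j) : ℝ) : ℂ) * (t ^ 2) ^ k := by
  have hT : (LaurentPolynomial.T 1 * LaurentPolynomial.T (-1) : ℂ[T;T⁻¹]) = 1 := by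
    rw [← LaurentPolynomial.T_add]; simp
  have hfactor : (aeval (LaurentPolynomial.T 1 + LaurentPolynomial.T (-1) : ℂ[T;T⁻¹]))
      (∏ i, (C (1 + (ρ i * t) ^ 2) + C (ρ i * t) * X)) =
      (∏ i, (1 + algebraMap ℂ ℂ[T;T⁻¹] (ρ i) * (algebraMap ℂ ℂ[T;T⁻¹] t * LaurentPolynomial.T 1))) *
      ∏ i, (1 + algebraMap ℂ ℂ[T;T⁻¹] (ρ i) *
        (algebraMap ℂ ℂ[T;T⁻¹] t * LaurentPolynomial.T (-1))) := by
    rw [map_prod, ← Finset.prod_mul_distrib]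
    refine Finset.prod_congr rfl fun i _ => ?_
    simp only [map_add, map_mul, map_pow, aeval_X, aeval_C, map_one]
    linear_combination (-(algebraMap ℂ ℂ[T;T⁻¹] (ρ i) * algebraMap ℂ ℂ[T;T⁻¹] t) ^ 2) * hT
  have hexpand : (aeval (LaurentPolynomial.T 1 + LaurentPolynomial.T (-1) : ℂ[T;T⁻¹]))
      (∏ i, (C (1 + (ρ i * t) ^ 2) + C (ρ i * t) * X)) =
      ∑ m ∈ Finset.range (n + 1), ∑ l ∈ Finset.range (n + 1),
        ((a m : ℂ) * a l * t ^ (m + l)) • LaurentPolynomial.T ((m : ℤ) - l) := by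
    rw [hfactor, prod_eq_sum_of_eval hψ, prod_eq_sum_of_eval hψ, Finset.sum_mul_sum]
    refine Finset.sum_congr rfl fun m _ => Finset.sum_congr rfl fun l _ => ?_
    rw [mul_pow, mul_pow, LaurentPolynomial.T_pow, LaurentPolynomial.T_pow,
      Algebra.smul_def, show (m : ℤ) - l = m * 1 + l * (-1) by ring, LaurentPolynomial.T_add]
    simp only [map_mul, map_pow]
    ring
  let H : ℤ → ℂ := fun j => ∑ k ∈ Finset.range (n + 1),
    (a (k - j) : ℂ) * a (k + j) * (t ^ 2) ^ k
  have hH : ∀ j, H (-j) = H j := fun j => Finset.sum_congr rfl fun k _ => by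
    rw [sub_neg_eq_add, ← sub_eq_add_neg]; ring
  have hdiag : ∀ j : ℤ, ∑ m ∈ Finset.range (n + 1), ∑ l ∈ Finset.range (n + 1),
      (if 2 * j + (m - l) = 0 then (a m : ℂ) * a l * t ^ (m + l) else 0) = H j := fun j =>
    sum_sum_ite_eq_sum_symm (a := fun k => (a k : ℂ)) (fun k hk => by simp [ha k hk]) t j
  have hsum : symFunctional p (∏ i, (C (1 + (ρ i * t) ^ 2) + C (ρ i * t) * X)) =
      ∑ r ∈ Finset.range (2 * p + 1), (-1 : ℂ) ^ r * ((2 * p).choose r : ℂ) * H (r - p) := by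
    rw [symFunctional_apply, hexpand]
    simp only [map_sum, map_smul, smul_eq_mul, constCoeffWeighted_T, Finset.mul_sum, ← hdiag]
    rw [Finset.sum_congr rfl fun m _ => Finset.sum_comm, Finset.sum_comm]
    refine Finset.sum_congr rfl fun r _ => Finset.sum_congr rfl fun m _ =>
      Finset.sum_congr rfl fun l _ => ?_
    rw [mul_sub]
    split_ifs <;> ring
  rw [hsum, sum_alternating_choose_of_even hH hp]
  congr 1
  simp only [H, Finset.mul_sum]
  rw [Finset.sum_comm, ← Finset.sum_add_distrib]
  refine Finset.sum_congr rfl fun k _ => ?_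
  push_cast
  rw [add_mul, Finset.sum_mul]
  congr 1
  · simp; ring
  · exact Finset.sum_congr rfl fun j _ => by ring

theorem re_add_inv_pos {w : ℂ} (hw : 0 < w.re) : 0 < (w + w⁻¹).re := by
  have hw0 : w ≠ 0 := fun h => by simp [h] at hw
  rw [Complex.add_re, Complex.inv_re]
  have := div_pos hw (Complex.normSq_pos.2 hw0)
  linarith

theorem symFunctional_prod_ne_zero {n : ℕ} (p : ℕ) {w : Fin n → ℂ} (hw : ∀ i, 0 < (w i).re) :
    symFunctional p (∏ i, (C (1 + w i ^ 2) + C (w i) * X)) ≠ 0 := by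
  have hw0 : ∀ i, w i ≠ 0 := fun i h => by simpa [h] using hw i
  have : (∏ i, (C (1 + w i ^ 2) + C (w i) * X) : ℂ[X]) =
      (∏ i, w i) • ((Finset.univ.val.map fun i => w i + (w i)⁻¹).map fun κ => X + C κ).prod := by
    rw [Multiset.map_map, smul_eq_C_mul, map_prod]
    change _ = _ * ∏ i, (X + C (w i + (w i)⁻¹))
    rw [← Finset.prod_mul_distrib]
    refine Finset.prod_congr rfl fun i _ => ?_
    rw [mul_add, ← C_mul, mul_add, mul_inv_cancel₀ (hw0 i)]
    rw [add_comm 1, pow_two, add_comm]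
  rw [this, map_smul, smul_eq_mul]
  refine mul_ne_zero (Finset.prod_ne_zero_iff.2 fun i _ => hw0 i)
    (functional_prod_X_add_C_ne_zero _ _ ?_ fun x hx => symFunctional_X_add_C_pow_ne_zero _ p hx)
  intro κ hκ
  obtain ⟨i, -, rfl⟩ := Multiset.mem_map.1 hκ
  exact re_add_inv_pos (hw i)

/-- Every complex number off the closed negative real axis has a square root of positive
real part. -/
theorem exists_sq_eq_re_pos {z : ℂ} (hz : ∀ x : ℝ, x ≤ 0 → z ≠ x) :
    ∃ t : ℂ, z = t ^ 2 ∧ 0 < t.re := by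
  obtain ⟨t, ht⟩ := IsAlgClosed.exists_pow_nat_eq z two_pos
  rcases lt_trichotomy t.re 0 with h | h | h
  · exact ⟨-t, by rw [neg_sq, ht], by simpa using h⟩
  · refine absurd ?_ (hz (-t.im ^ 2) (by nlinarith [sq_nonneg t.im]))
    rw [← ht]
    apply Complex.ext <;> simp [pow_two, h]
  · exact ⟨t, ht.symm, h⟩

/-- Main theorem: if `ψ(z) = ∑ a_k z^k = ∏ (1 + ρ_k z)` with all `ρ_k > 0`, then for every
positive integer `p` the polynomial `∑ L_k^p z^k`, where
`L_k^p = C(2p-1,p) a_k² + ∑_{j=1}^p (-1)^j C(2p,p-j) a_{k-j} a_{k+j}`, has all zeros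
real and negative. -/
theorem Lkp_preserves_real_negative_zeros (n p : ℕ) (hn : 0 < n) (hp : 0 < p)
    (a : ℤ → ℝ) (ρ : Fin n → ℝ) (hρ : ∀ i, 0 < ρ i)
    (ha : ∀ k : ℤ, (k < 0 ∨ (n : ℤ) < k) → a k = 0)
    (hψ : ∀ z : ℂ, ∑ k ∈ Finset.range (n + 1), (a (k : ℤ) : ℂ) * z ^ k =
        ∏ i, (1 + (ρ i : ℂ) * z)) :
    ∀ z : ℂ,
      (∑ k ∈ Finset.range (n + 1),
          ((((2 * p - 1).choose p : ℝ) * (a (k : ℤ)) ^ 2 +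
            ∑ j ∈ Finset.Icc 1 p,
              (-1 : ℝ) ^ j * ((2 * p).choose (p - j) : ℝ) *
                a ((k : ℤ) - j) * a ((k : ℤ) + j) : ℝ) : ℂ) * z ^ k) = 0 →
      ∃ x : ℝ, x < 0 ∧ z = (x : ℂ) := by
  intro z hz
  by_contra! hcon
  rcases eq_or_ne z 0 with rfl | hz0
  · have ha0 : (a 0 : ℂ) = 1 := by
      have := hψ 0
      rw [Finset.sum_range_succ', Finset.sum_eq_zero (by simp)] at this
      simpa using this
    have hterm : ∑ j ∈ Finset.Icc 1 p, (-1 : ℝ) ^ j * ((2 * p).choose (p - j) : ℝ) *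
        a (((0 : ℕ) : ℤ) - j) * a (((0 : ℕ) : ℤ) + j) = 0 :=
      Finset.sum_eq_zero fun j hj => by
        have := (Finset.mem_Icc.1 hj).1
        rw [ha (((0 : ℕ) : ℤ) - j) (by omega)]; simp
    rw [Finset.sum_range_succ', Finset.sum_eq_zero (by simp), hterm] at hz
    simp [ha0] at hz
    exact (Nat.choose_pos (show p ≤ 2 * p - 1 by omega)).ne' hz
  · obtain ⟨t, rfl, ht⟩ := exists_sq_eq_re_pos (z := z) fun x hx hzx => by
      rcases hx.lt_or_eq with h | h
      · exact hcon x h hzx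
      · exact hz0 (by rw [hzx, h]; simp)
    have := symFunctional_prod_ne_zero p (w := fun i => (ρ i : ℂ) * t) fun i => by
      rw [Complex.re_ofReal_mul]; exact mul_pos (hρ i) ht
    rw [symFunctional_prod hp ha hψ t, hz, mul_zero] at this
    exact this rfl
end

section
/- If the real polynomial ψ(z) = ∑_{k=0}^{n} a_k z^k has all zeros real and negative (and a_{-1} := 0, a_{n+1} := 0), then the polynomial ∑_{k=0}^{n} (a_k^2 - a_{k-1} a_{k+1}) z^k has all zeros real and negative. -/
namespace StanleyConjecture

open Polynomial

/-- All zeros lie in the open left half-plane (in particular the polynomial is nonzero). -/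
def Hurwitz (p : ℂ[X]) : Prop := ∀ z : ℂ, p.eval z = 0 → z.re < 0

lemma Hurwitz.ne_zero {p : ℂ[X]} (hp : Hurwitz p) : p ≠ 0 := by
  rintro rfl
  simpa using hp 0 (by simp)

lemma Hurwitz.pow {p : ℂ[X]} (hp : Hurwitz p) (n : ℕ) : Hurwitz (p ^ n) := by
  intro z hz
  rw [eval_pow] at hz
  exact hp z (eq_zero_of_pow_eq_zero hz)

lemma Hurwitz.re_lt_zero_of_mem_roots {p : ℂ[X]} (hp : Hurwitz p) {r : ℂ} (hr : r ∈ p.roots) :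
    r.re < 0 :=
  hp r (isRoot_of_mem_roots hr)

lemma Hurwitz.derivative {p : ℂ[X]} (hp : Hurwitz p) (h : 0 < p.natDegree) :
    Hurwitz (derivative p) := by
  intro z hz
  have hdeg : 0 < p.degree := natDegree_pos_iff_degree_pos.mp h
  have hne : Polynomial.derivative p ≠ 0 := fun h0 =>
    h.ne' (derivative_eq_zero.mp h0)
  have hmem : z ∈ (Polynomial.derivative p).rootSet ℂ := by
    rw [mem_rootSet, coe_aeval_eq_eval]
    exact ⟨hne, hz⟩
  have hsub : convexHull ℝ (p.rootSet ℂ) ⊆ {c : ℂ | c.re < 0} := by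
    refine convexHull_min ?_ (convex_halfSpace_re_lt 0)
    intro w hw
    rw [mem_rootSet, coe_aeval_eq_eval] at hw
    exact hp w hw.2
  exact hsub (rootSet_derivative_subset_convexHull_rootSet hdeg hmem)

lemma Hurwitz.coeff_ne_zero {k : ℕ} {p : ℂ[X]} (hp : Hurwitz p) (hk : k ≤ p.natDegree) :
    p.coeff k ≠ 0 := by
  induction k generalizing p with
  | zero =>
    intro h
    rw [coeff_zero_eq_eval_zero] at h
    simpa using hp 0 h
  | succ k ih =>
    have h1 : k ≤ (Polynomial.derivative p).natDegree := by
      rw [natDegree_derivative]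
      omega
    have h2 := ih (hp.derivative (by omega)) h1
    rw [coeff_derivative] at h2
    exact left_ne_zero_of_mul h2

lemma inv_re_neg {z : ℂ} (hz : z.re < 0) : (z⁻¹).re < 0 := by
  have hz0 : z ≠ 0 := by rintro rfl; simp at hz
  rw [Complex.inv_re]
  exact div_neg_of_neg_of_pos hz (Complex.normSq_pos.mpr hz0)

lemma inv_re_nonneg {z : ℂ} (hz : 0 ≤ z.re) : 0 ≤ (z⁻¹).re := by
  rw [Complex.inv_re]
  exact div_nonneg hz (Complex.normSq_nonneg z)

lemma re_multiset_sum_neg {s : Multiset ℂ} (hs : ∀ z ∈ s, z.re < 0) (h0 : s ≠ 0) :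
    s.sum.re < 0 := by
  induction s using Multiset.induction_on with
  | empty => exact absurd rfl h0
  | cons a s ih =>
    rw [Multiset.sum_cons, Complex.add_re]
    have ha := hs a (Multiset.mem_cons_self a s)
    by_cases hs0 : s = 0
    · simpa [hs0] using ha
    · have := ih (fun z hz => hs z (Multiset.mem_cons_of_mem hz)) hs0
      linarith

/-- The polar derivative of `f`, viewed as a polynomial of degree `n`, with pole `v`. -/
noncomputable def polarDerivative (n : ℕ) (v : ℂ) (f : ℂ[X]) : ℂ[X] :=
  C (n : ℂ) * f + (C v - X) * derivative f

lemma coeff_polarDerivative (n : ℕ) (v : ℂ) (f : ℂ[X]) (k : ℕ) :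
    (polarDerivative n v f).coeff k =
      ((n : ℂ) - k) * f.coeff k + v * ((k + 1) * f.coeff (k + 1)) := by
  rw [polarDerivative, sub_mul, coeff_add, coeff_sub, coeff_C_mul, coeff_C_mul, coeff_derivative]
  cases k with
  | zero => simp
  | succ k => rw [coeff_X_mul, coeff_derivative]; push_cast; ring

lemma natDegree_polarDerivative {n : ℕ} {v : ℂ} (hv : v.re = 0) {f : ℂ[X]} (hf : Hurwitz f)
    (hn : f.natDegree = n + 1) : (polarDerivative (n + 1) v f).natDegree = n := by
  apply natDegree_eq_of_le_of_coeff_ne_zero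
  · rw [natDegree_le_iff_coeff_eq_zero]
    intro k hk
    rw [coeff_polarDerivative]
    rcases Nat.lt_or_ge (n + 1) k with h | h
    · rw [coeff_eq_zero_of_natDegree_lt (by omega), coeff_eq_zero_of_natDegree_lt (by omega)]
      simp
    · obtain rfl : k = n + 1 := by omega
      rw [coeff_eq_zero_of_natDegree_lt (n := n + 1 + 1) (by omega)]
      simp
  · have hsplit := IsAlgClosed.splits f
    have h1 := hsplit.nextCoeff_eq_neg_sum_roots_mul_leadingCoeff
    rw [nextCoeff_of_natDegree_pos (by omega), hn, Nat.add_sub_cancel] at h1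
    have h2 : f.coeff (n + 1) = f.leadingCoeff := by rw [leadingCoeff, hn]
    rw [coeff_polarDerivative, h1, h2]
    have hsum : f.roots.sum.re < 0 := by
      apply re_multiset_sum_neg fun z hz => hf.re_lt_zero_of_mem_roots hz
      intro h0
      have := hsplit.natDegree_eq_card_roots
      simp [h0, hn] at this
    intro h
    have h3 : f.leadingCoeff * (((n : ℂ) + 1) * v - f.roots.sum) = 0 := by
      rw [← h]; push_cast; ring
    rcases mul_eq_zero.mp h3 with h4 | h4
    · exact hf.ne_zero (leadingCoeff_eq_zero.mp h4)
    · have := congrArg Complex.re h4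
      simp [hv] at this
      linarith

/-- Laguerre's theorem for the left half-plane and a pole on its boundary. -/
lemma Hurwitz.polarDerivative {n : ℕ} {v : ℂ} (hv : v.re = 0) {f : ℂ[X]} (hf : Hurwitz f)
    (hn : f.natDegree = n + 1) : Hurwitz (polarDerivative (n + 1) v f) := by
  intro z hz
  by_contra! hre
  have hfz : f.eval z ≠ 0 := fun h => absurd (hf z h) (not_lt.mpr hre)
  have hsplit := IsAlgClosed.splits f
  have hcard := hsplit.natDegree_eq_card_roots
  rw [hn] at hcard
  simp only [StanleyConjecture.polarDerivative, eval_add, eval_mul, eval_sub, eval_C, eval_X] at hz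
  have hzv : z - v ≠ 0 := by
    intro h
    rw [sub_eq_zero] at h
    subst h
    rw [sub_self, zero_mul, add_zero, mul_eq_zero] at hz
    rcases hz with hz | hz
    · exact Nat.cast_ne_zero.mpr n.succ_ne_zero hz
    · exact hfz hz
  have hlog := hsplit.eval_derivative_div_eval_of_ne_zero hfz
  have hsum : (f.roots.map fun r => (z - v) * ((z - v) * (1 / (z - r)) - 1)).sum = 0 := by
    rw [Multiset.sum_map_mul_left, Multiset.sum_map_sub, Multiset.sum_map_mul_left, ← hlog,
      Multiset.map_const', Multiset.sum_replicate, ← hcard]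
    have : (z - v) * (eval z (Polynomial.derivative f) / eval z f) = ((n + 1 : ℕ) : ℂ) := by
      rw [← mul_div_assoc, div_eq_iff hfz]
      linear_combination -hz
    rw [this]
    simp
  have hneg : (f.roots.map fun r => (z - v) * ((z - v) * (1 / (z - r)) - 1)).sum.re < 0 := by
    apply re_multiset_sum_neg
    · intro y hy
      obtain ⟨r, hr, rfl⟩ := Multiset.mem_map.mp hy
      have hr0 := hf.re_lt_zero_of_mem_roots hr
      have hzr : z - r ≠ 0 := by
        intro h
        have := congrArg Complex.re h
        simp at this
        linarith
      have hrv : r - v ≠ 0 := by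
        intro h
        have := congrArg Complex.re h
        simp [hv] at this
        linarith
      have key : (z - v) * ((z - v) * (1 / (z - r)) - 1) = ((r - v)⁻¹ - (z - v)⁻¹)⁻¹ := by
        rw [inv_sub_inv hrv hzv, inv_div, show z - v - (r - v) = z - r by ring]
        field_simp
        ring
      rw [key]
      apply inv_re_neg
      rw [Complex.sub_re]
      have h1 : ((r - v)⁻¹).re < 0 := inv_re_neg (by simpa [hv] using hr0)
      have h2 : 0 ≤ ((z - v)⁻¹).re := inv_re_nonneg (by simpa [hv] using hre)
      linarith
    · intro h0
      rw [Multiset.map_eq_zero] at h0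
      simp [h0] at hcard
  rw [hsum] at hneg
  simp at hneg

/-- The apolarity pairing of two polynomials of degree at most `n`, up to normalization. -/
noncomputable def apolarPairing (n : ℕ) (f g : ℂ[X]) : ℂ :=
  ∑ k ∈ Finset.range (n + 1),
    (-1) ^ k * (k.factorial : ℂ) * ((n - k).factorial : ℂ) * f.coeff k * g.coeff (n - k)

lemma apolarPairing_X_sub_C_mul {n : ℕ} (v : ℂ) (f g : ℂ[X]) (hg : g.natDegree ≤ n) :
    apolarPairing (n + 1) f ((X - C v) * g) =
      apolarPairing n (polarDerivative (n + 1) v f) g := by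
  have hg0 : g.coeff (n + 1) = 0 := coeff_eq_zero_of_natDegree_lt (by omega)
  have hX : apolarPairing (n + 1) f ((X - C v) * g) =
      (∑ k ∈ Finset.range (n + 1 + 1), (-1) ^ k * (k.factorial : ℂ) *
        ((n + 1 - k).factorial : ℂ) * f.coeff k * (X * g).coeff (n + 1 - k)) -
      ∑ k ∈ Finset.range (n + 1 + 1), v * ((-1) ^ k * (k.factorial : ℂ) *
        ((n + 1 - k).factorial : ℂ) * f.coeff k * g.coeff (n + 1 - k)) := by
    rw [apolarPairing, ← Finset.sum_sub_distrib]
    refine Finset.sum_congr rfl fun k _ => ?_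
    rw [sub_mul, coeff_sub, coeff_C_mul]
    ring
  rw [hX, Finset.sum_range_succ, Finset.sum_range_succ' _ (n + 1)]
  simp only [Nat.sub_self, Nat.sub_zero, hg0, coeff_X_mul_zero, mul_zero, add_zero]
  rw [apolarPairing, ← Finset.sum_sub_distrib]
  refine Finset.sum_congr rfl fun k hk => ?_
  have hk' : k ≤ n := Nat.lt_succ_iff.mp (Finset.mem_range.mp hk)
  obtain ⟨m, rfl⟩ := Nat.exists_eq_add_of_le hk'
  rw [show k + m + 1 - k = m + 1 by omega, show k + m + 1 - (k + 1) = m by omega,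
    show k + m - k = m by omega, coeff_X_mul, coeff_polarDerivative, Nat.factorial_succ,
    Nat.factorial_succ]
  push_cast
  ring

/-- Grace's apolarity theorem for the left half-plane and zeros on its boundary. -/
lemma apolarPairing_prod_ne_zero (V : Multiset ℂ) (hV : ∀ v ∈ V, v.re = 0) {f : ℂ[X]}
    (hf : Hurwitz f) (hn : f.natDegree = V.card) :
    apolarPairing V.card f (V.map fun v => X - C v).prod ≠ 0 := by
  induction V using Multiset.induction_on generalizing f with
  | empty => simpa [apolarPairing] using hf.coeff_ne_zero (Nat.zero_le _)
  | cons v V ih =>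
    rw [Multiset.card_cons] at hn ⊢
    have hv := hV v (Multiset.mem_cons_self v V)
    rw [Multiset.map_cons, Multiset.prod_cons, apolarPairing_X_sub_C_mul _ _ _
      (natDegree_multiset_prod_X_sub_C_eq_card V).le]
    exact ih (fun w hw => hV w (Multiset.mem_cons_of_mem hw)) (hf.polarDerivative hv hn)
      (natDegree_polarDerivative hv hf hn)

/-- The polynomial `X ^ n * f (X + X⁻¹)`, for `f` of degree at most `n`. -/
noncomputable def palindromize (n : ℕ) (f : ℂ[X]) : ℂ[X] :=
  ∑ k ∈ Finset.range (n + 1), C (f.coeff k) * (X ^ (n - k) * (1 + X ^ 2) ^ k)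

lemma palindromize_X_add_C_mul {n : ℕ} (u : ℂ) (f : ℂ[X]) (hf : f.natDegree ≤ n) :
    palindromize (n + 1) ((X + C u) * f) = (1 + C u * X + X ^ 2) * palindromize n f := by
  have hf0 : f.coeff (n + 1) = 0 := coeff_eq_zero_of_natDegree_lt (by omega)
  have hX : palindromize (n + 1) ((X + C u) * f) =
      (∑ k ∈ Finset.range (n + 1 + 1),
        C ((X * f).coeff k) * (X ^ (n + 1 - k) * (1 + X ^ 2) ^ k)) +
      ∑ k ∈ Finset.range (n + 1 + 1),
        C u * (C (f.coeff k) * (X ^ (n + 1 - k) * (1 + X ^ 2) ^ k)) := by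
    rw [palindromize, ← Finset.sum_add_distrib]
    refine Finset.sum_congr rfl fun k _ => ?_
    rw [add_mul, coeff_add, coeff_C_mul, C_add, C_mul]
    ring
  rw [hX, Finset.sum_range_succ' _ (n + 1), Finset.sum_range_succ _ (n + 1)]
  simp only [hf0, coeff_X_mul_zero, C_0, zero_mul, mul_zero, add_zero]
  rw [palindromize, ← Finset.sum_add_distrib, Finset.mul_sum]
  refine Finset.sum_congr rfl fun k hk => ?_
  have hk' : k ≤ n := Nat.lt_succ_iff.mp (Finset.mem_range.mp hk)
  rw [coeff_X_mul, show n + 1 - (k + 1) = n - k by omega, show n + 1 - k = n - k + 1 by omega]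
  ring

lemma natDegree_prod_X_add_C (U : Multiset ℂ) :
    (U.map fun u => X + C u).prod.natDegree = U.card := by
  rw [natDegree_multiset_prod_of_monic]
  · simp
  · intro p hp
    obtain ⟨u, -, rfl⟩ := Multiset.mem_map.mp hp
    exact monic_X_add_C u

lemma palindromize_prod (U : Multiset ℂ) :
    palindromize U.card (U.map fun u => X + C u).prod =
      (U.map fun u => 1 + C u * X + X ^ 2).prod := by
  induction U using Multiset.induction_on with
  | empty => simp [palindromize]
  | cons u U ih =>
    rw [Multiset.card_cons, Multiset.map_cons, Multiset.prod_cons, palindromize_X_add_C_mul _ _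
      (natDegree_prod_X_add_C U).le, ih, Multiset.map_cons, Multiset.prod_cons]

/-- The moments of the semicircle law: Catalan numbers in even degree, zero in odd degree. -/
noncomputable def semicircleMoment (k : ℕ) : ℂ :=
  ((1 + X ^ 2 : ℂ[X]) ^ k).coeff k - ((1 + X ^ 2 : ℂ[X]) ^ k).coeff (k + 2)

lemma semicircleMoment_zero : semicircleMoment 0 = 1 := by
  simp [semicircleMoment, coeff_one]

lemma neg_one_pow_mul_semicircleMoment (k : ℕ) :
    (-1) ^ k * semicircleMoment k = semicircleMoment k := by
  rcases Nat.even_or_odd k with hk | hk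
  · rw [hk.neg_one_pow, one_mul]
  · have hexp : (1 + X ^ 2 : ℂ[X]) ^ k = expand ℂ 2 ((1 + X) ^ k) := by simp
    have h1 : ¬ 2 ∣ k := by rw [← even_iff_two_dvd]; exact Nat.not_even_iff_odd.mpr hk
    have h2 : ¬ 2 ∣ k + 2 := by omega
    rw [semicircleMoment, hexp, coeff_expand two_pos, coeff_expand two_pos, if_neg h1, if_neg h2]
    simp

lemma coeff_palindromize_sub (n : ℕ) (f : ℂ[X]) :
    (palindromize n f).coeff n - (palindromize n f).coeff (n + 2) =
      ∑ k ∈ Finset.range (n + 1), f.coeff k * semicircleMoment k := by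
  rw [palindromize, finsetSum_coeff, finsetSum_coeff, ← Finset.sum_sub_distrib]
  refine Finset.sum_congr rfl fun k hk => ?_
  have hk' : k ≤ n := Nat.lt_succ_iff.mp (Finset.mem_range.mp hk)
  obtain ⟨m, rfl⟩ := Nat.exists_eq_add_of_le hk'
  rw [coeff_C_mul, coeff_C_mul, semicircleMoment, show k + m - k = m by omega,
    show k + m + 2 = k + 2 + m by omega, coeff_X_pow_mul, coeff_X_pow_mul, mul_sub]

lemma re_neg_of_palindromic_quadratic {t q : ℂ} (ht : 0 < t.re) (hq : 1 + t * q + q ^ 2 = 0) :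
    q.re < 0 := by
  by_contra! h
  have hq0 : q ≠ 0 := by rintro rfl; simp at hq
  have : t = -(q⁻¹ + q) := by
    field_simp
    linear_combination hq
  have h2 := inv_re_nonneg h
  rw [this, Complex.neg_re, Complex.add_re] at ht
  linarith

lemma hurwitz_palindromic_quadratic {t : ℂ} (ht : 0 < t.re) :
    Hurwitz (1 + C t * X + X ^ 2) := by
  intro q hq
  exact re_neg_of_palindromic_quadratic ht (by simpa using hq)

lemma coeff_palindromic_quadratic_pow_sub (n : ℕ) (t : ℂ) :
    ((n : ℂ) + 1) * (((1 + C t * X + X ^ 2) ^ n).coeff n -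
      ((1 + C t * X + X ^ 2) ^ n).coeff (n + 2)) =
      ((1 + C t * X + X ^ 2) ^ (n + 1)).coeff (n + 2) := by
  set S : ℂ[X] := (1 + C t * X + X ^ 2) ^ n with hS
  set R : ℂ[X] := (1 + C t * X + X ^ 2) ^ (n + 1) with hR
  have key : X * derivative R - C ((n : ℂ) + 1) * R = C ((n : ℂ) + 1) * (S * X ^ 2 - S) := by
    have : derivative R = C ((n : ℂ) + 1) * S * (C t + 2 * X) := by
      rw [hR, hS, derivative_pow]
      simp
      left
      norm_num
    rw [this, hR, pow_succ, ← hS]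
    ring
  have h := congrArg (fun p => coeff p (n + 2)) key
  simp only [coeff_sub, coeff_C_mul, coeff_X_mul, coeff_derivative, coeff_mul_X_pow] at h
  push_cast at h
  linear_combination -h

/-- The polynomial whose apolarity functional is integration against the semicircle law. -/
noncomputable def semicirclePolynomial (n : ℕ) : ℂ[X] :=
  ∑ k ∈ Finset.range (n + 1), C ((n.choose k : ℂ) * semicircleMoment k) * X ^ (n - k)

lemma coeff_semicirclePolynomial {n k : ℕ} (hk : k ≤ n) :
    (semicirclePolynomial n).coeff (n - k) = (n.choose k : ℂ) * semicircleMoment k := by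
  rw [semicirclePolynomial, finsetSum_coeff, Finset.sum_eq_single k]
  · rw [coeff_C_mul_X_pow, if_pos rfl]
  · intro b hb hbk
    have : b ≤ n := Nat.lt_succ_iff.mp (Finset.mem_range.mp hb)
    rw [coeff_C_mul_X_pow, if_neg (by omega)]
  · intro h
    exact absurd (Finset.mem_range.mpr (Nat.lt_succ_of_le hk)) h

lemma natDegree_semicirclePolynomial (n : ℕ) : (semicirclePolynomial n).natDegree = n := by
  apply natDegree_eq_of_le_of_coeff_ne_zero
  · refine natDegree_sum_le_of_forall_le _ _ fun k _ => ?_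
    exact (natDegree_C_mul_X_pow_le _ _).trans (Nat.sub_le n k)
  · have := coeff_semicirclePolynomial (Nat.zero_le n)
    rw [Nat.sub_zero] at this
    simp [this, semicircleMoment_zero]

lemma eval_semicirclePolynomial (n : ℕ) (t : ℂ) :
    (semicirclePolynomial n).eval t = ((1 + C t * X + X ^ 2) ^ n).coeff n -
      ((1 + C t * X + X ^ 2) ^ n).coeff (n + 2) := by
  have h := palindromize_prod (Multiset.replicate n t)
  simp only [Multiset.card_replicate, Multiset.map_replicate, Multiset.prod_replicate] at h
  rw [← h, coeff_palindromize_sub, semicirclePolynomial, eval_finsetSum]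
  refine Finset.sum_congr rfl fun k _ => ?_
  rw [coeff_X_add_C_pow]
  simp only [eval_mul, eval_C, eval_pow, eval_X]
  ring

lemma eval_semicirclePolynomial_ne_zero (n : ℕ) {t : ℂ} (ht : 0 < t.re) :
    (semicirclePolynomial n).eval t ≠ 0 := by
  intro h
  rw [eval_semicirclePolynomial] at h
  have h1 := coeff_palindromic_quadratic_pow_sub n t
  rw [h, mul_zero] at h1
  refine ((hurwitz_palindromic_quadratic ht).pow (n + 1)).coeff_ne_zero ?_ h1.symm
  have : (1 + C t * X + X ^ 2 : ℂ[X]).natDegree = 2 := by compute_degree!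
  rw [natDegree_pow, this]
  omega

lemma eval_neg_semicirclePolynomial (n : ℕ) (t : ℂ) :
    (semicirclePolynomial n).eval (-t) = (-1) ^ n * (semicirclePolynomial n).eval t := by
  rw [semicirclePolynomial, eval_finsetSum, eval_finsetSum, Finset.mul_sum]
  refine Finset.sum_congr rfl fun k hk => ?_
  have hk' : k ≤ n := Nat.lt_succ_iff.mp (Finset.mem_range.mp hk)
  obtain ⟨m, rfl⟩ := Nat.exists_eq_add_of_le hk'
  simp only [eval_mul, eval_C, eval_pow, eval_X, Nat.add_sub_cancel_left]
  rw [neg_pow, pow_add]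
  nth_rewrite 1 [← neg_one_pow_mul_semicircleMoment k]
  ring

lemma re_eq_zero_of_eval_semicirclePolynomial {n : ℕ} {t : ℂ}
    (h : (semicirclePolynomial n).eval t = 0) : t.re = 0 := by
  rcases lt_trichotomy t.re 0 with ht | ht | ht
  · refine absurd ?_ (eval_semicirclePolynomial_ne_zero n (t := -t) (by simpa using ht))
    rw [eval_neg_semicirclePolynomial, h, mul_zero]
  · exact ht
  · exact absurd h (eval_semicirclePolynomial_ne_zero n ht)

lemma sum_coeff_mul_semicircleMoment_ne_zero {n : ℕ} {f : ℂ[X]} (hf : Hurwitz f)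
    (hn : f.natDegree = n) :
    ∑ k ∈ Finset.range (n + 1), f.coeff k * semicircleMoment k ≠ 0 := by
  set g := semicirclePolynomial n with hg
  have hsplit := IsAlgClosed.splits g
  have hg0 : g ≠ 0 := by
    intro h
    exact eval_semicirclePolynomial_ne_zero n (t := 1) (by simp) (by rw [← hg, h, eval_zero])
  have hcard : g.roots.card = n := by
    rw [← hsplit.natDegree_eq_card_roots, hg, natDegree_semicirclePolynomial]
  have h1 := apolarPairing_prod_ne_zero g.roots
    (fun v hv => re_eq_zero_of_eval_semicirclePolynomial (isRoot_of_mem_roots hv)) hf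
    (hn.trans hcard.symm)
  rw [hcard] at h1
  intro h
  apply h1
  have h2 : g.leadingCoeff * apolarPairing n f (g.roots.map fun v => X - C v).prod =
      apolarPairing n f g := by
    conv_rhs => rw [hsplit.eq_prod_roots]
    rw [apolarPairing, apolarPairing, Finset.mul_sum]
    refine Finset.sum_congr rfl fun k _ => ?_
    rw [coeff_C_mul]
    ring
  have h3 : apolarPairing n f g =
      (n.factorial : ℂ) * ∑ k ∈ Finset.range (n + 1), f.coeff k * semicircleMoment k := by
    rw [apolarPairing, Finset.mul_sum]
    refine Finset.sum_congr rfl fun k hk => ?_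
    have hk' : k ≤ n := Nat.lt_succ_iff.mp (Finset.mem_range.mp hk)
    rw [hg, coeff_semicirclePolynomial hk', ← Nat.choose_mul_factorial_mul_factorial hk']
    nth_rewrite 2 [← neg_one_pow_mul_semicircleMoment k]
    push_cast
    ring
  rw [h3, h, mul_zero] at h2
  exact (mul_eq_zero.mp h2).resolve_left (leadingCoeff_ne_zero.mpr hg0)

lemma coeff_prod_palindromic_quadratic_ne (U : Multiset ℂ) (hU : ∀ u ∈ U, 0 < u.re) :
    (U.map fun u => 1 + C u * X + X ^ 2).prod.coeff U.card ≠
      (U.map fun u => 1 + C u * X + X ^ 2).prod.coeff (U.card + 2) := by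
  rw [← sub_ne_zero, ← palindromize_prod, coeff_palindromize_sub]
  apply sum_coeff_mul_semicircleMoment_ne_zero _ (natDegree_prod_X_add_C U)
  intro z hz
  rw [eval_multiset_prod, Multiset.prod_eq_zero_iff, Multiset.map_map] at hz
  obtain ⟨u, hu, huz⟩ := Multiset.mem_map.mp hz
  have h1 := hU u hu
  have h2 := congrArg Complex.re huz
  simp at h2
  linarith

lemma coeff_mul_reverse_natDegree (p : ℂ[X]) :
    (p * p.reverse).coeff p.natDegree =
      ∑ k ∈ Finset.range (p.natDegree + 1), p.coeff k ^ 2 := by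
  rw [coeff_mul, Finset.Nat.sum_antidiagonal_eq_sum_range_succ_mk]
  refine Finset.sum_congr rfl fun k hk => ?_
  have hk' : k ≤ p.natDegree := Nat.lt_succ_iff.mp (Finset.mem_range.mp hk)
  rw [coeff_reverse, revAt_le (Nat.sub_le _ _), Nat.sub_sub_self hk', sq]

lemma coeff_mul_reverse_natDegree_add_two (p : ℂ[X]) :
    (p * p.reverse).coeff (p.natDegree + 2) =
      ∑ k ∈ Finset.range (p.natDegree + 1), p.coeff (k + 2) * p.coeff k := by
  have hrev : ∀ k, p.natDegree < k → p.reverse.coeff k = 0 := fun k hk =>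
    coeff_eq_zero_of_natDegree_lt ((reverse_natDegree_le p).trans_lt hk)
  rw [coeff_mul, Finset.Nat.sum_antidiagonal_eq_sum_range_succ_mk, Nat.succ_eq_add_one,
    Finset.sum_range_succ', Finset.sum_range_succ']
  simp only
  rw [hrev (p.natDegree + 2 - 0) (by omega), hrev (p.natDegree + 2 - (0 + 1)) (by omega),
    mul_zero, mul_zero, add_zero, add_zero]
  refine Finset.sum_congr rfl fun k hk => ?_
  have hk' : k ≤ p.natDegree := Nat.lt_succ_iff.mp (Finset.mem_range.mp hk)
  rw [coeff_reverse, show p.natDegree + 2 - (k + 1 + 1) = p.natDegree - k by omega,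
    revAt_le (Nat.sub_le _ _), Nat.sub_sub_self hk']

lemma reverse_prod_linear (w : ℂ) (hw : w ≠ 0) (T : Multiset ℂ) (hT : ∀ r ∈ T, r ≠ 0) :
    (T.map fun r => C w * X - C r).prod.reverse = (T.map fun r => C w - C r * X).prod := by
  induction T using Multiset.induction_on with
  | empty => simpa using reverse_C (1 : ℂ)
  | cons r T ih =>
    have hr := hT r (Multiset.mem_cons_self r T)
    have hlin : (C w * X - C r : ℂ[X]).reverse = C w - C r * X := by
      have hd : (C w * X - C r : ℂ[X]).natDegree = 1 := by compute_degree!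
      have hd' : (C w - C r * X : ℂ[X]).natDegree ≤ 1 := by compute_degree!
      ext k
      rw [coeff_reverse, hd]
      match k with
      | 0 => rw [revAt_le (by omega)]; simp [coeff_C]
      | 1 => rw [revAt_le (by omega)]; simp [coeff_C]
      | k + 2 =>
        rw [revAt_eq_self_of_lt (by omega), coeff_eq_zero_of_natDegree_lt (by omega),
          coeff_eq_zero_of_natDegree_lt (by omega)]
    rw [Multiset.map_cons, Multiset.prod_cons, reverse_mul_of_domain, hlin,
      ih fun s hs => hT s (Multiset.mem_cons_of_mem hs), Multiset.map_cons, Multiset.prod_cons]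

/-- For a polynomial with negative zeros, the product of `P (w X)` and its reverse factors into
palindromic quadratics. -/
lemma mul_reverse_comp_eq {P : ℂ[X]} {w : ℂ} (hw : w ≠ 0) (h0 : ∀ r ∈ P.roots, r ≠ 0) :
    P.comp (C w * X) * (P.comp (C w * X)).reverse =
      C (P.leadingCoeff ^ 2 * (P.roots.map fun r => -(w * r)).prod) *
        ((P.roots.map fun r => -(w / r + r / w)).map fun u => 1 + C u * X + X ^ 2).prod := by
  have hcomp : P.comp (C w * X) =
      C P.leadingCoeff * (P.roots.map fun r => C w * X - C r).prod := by
    conv_lhs => rw [(IsAlgClosed.splits P).eq_prod_roots]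
    rw [mul_comp, C_comp, multiset_prod_comp, Multiset.map_map]
    simp
  rw [hcomp, reverse_mul_of_domain, reverse_C, reverse_prod_linear w hw _ h0]
  have hprod : (P.roots.map fun r => C w * X - C r).prod *
      (P.roots.map fun r => C w - C r * X).prod =
      C (P.roots.map fun r => -(w * r)).prod *
        ((P.roots.map fun r => -(w / r + r / w)).map fun u => 1 + C u * X + X ^ 2).prod := by
    rw [← Multiset.prod_map_mul, map_multiset_prod, Multiset.map_map, Multiset.map_map,
      ← Multiset.prod_map_mul]
    refine congrArg Multiset.prod (Multiset.map_congr rfl fun r hr => ?_)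
    have hr0 := h0 r hr
    have hC : C (-(w * r)) * C (-(w / r + r / w)) = (C (w ^ 2 + r ^ 2) : ℂ[X]) := by
      rw [← C_mul]
      congr 1
      field_simp
    simp only [Function.comp_apply]
    rw [mul_add, mul_add, ← mul_assoc, hC]
    simp only [C_add, C_mul, C_pow, C_neg]
    ring
  rw [C_mul, C_pow, mul_assoc (C P.leadingCoeff ^ 2), ← hprod]
  ring

theorem sum_coeff_sq_sub_ne_zero {P : ℂ[X]} (hP : P ≠ 0)
    (hroots : ∀ r ∈ P.roots, ∃ x : ℝ, x < 0 ∧ r = (x : ℂ)) {w : ℂ} (hw : 0 < w.re) :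
    ∑ k ∈ Finset.range (P.natDegree + 1), (P.coeff k * w ^ k) ^ 2 -
      ∑ k ∈ Finset.range (P.natDegree + 1),
        (P.coeff (k + 2) * w ^ (k + 2)) * (P.coeff k * w ^ k) ≠ 0 := by
  have hw0 : w ≠ 0 := by rintro rfl; simp at hw
  have h0 : ∀ r ∈ P.roots, r ≠ 0 := by
    intro r hr
    obtain ⟨x, hx, rfl⟩ := hroots r hr
    exact Complex.ofReal_ne_zero.mpr hx.ne
  have hdeg : (P.comp (C w * X)).natDegree = P.natDegree := by
    rw [natDegree_comp, natDegree_C_mul_X w hw0, mul_one]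
  have hsq := coeff_mul_reverse_natDegree (P.comp (C w * X))
  have hshift := coeff_mul_reverse_natDegree_add_two (P.comp (C w * X))
  simp only [hdeg, comp_C_mul_X_coeff] at hsq hshift
  rw [← hsq, ← hshift, mul_reverse_comp_eq hw0 h0, coeff_C_mul, coeff_C_mul, ← mul_sub]
  refine mul_ne_zero (mul_ne_zero (pow_ne_zero 2 (leadingCoeff_ne_zero.mpr hP)) ?_) ?_
  · rw [Ne, Multiset.prod_eq_zero_iff, Multiset.mem_map]
    rintro ⟨r, hr, h⟩
    exact mul_ne_zero hw0 (h0 r hr) (neg_eq_zero.mp h)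
  · rw [sub_ne_zero]
    have hcard : (P.roots.map fun r => -(w / r + r / w)).card = P.natDegree := by
      rw [Multiset.card_map, (IsAlgClosed.splits P).natDegree_eq_card_roots]
    rw [← hcard]
    apply coeff_prod_palindromic_quadratic_ne
    intro u hu
    obtain ⟨r, hr, rfl⟩ := Multiset.mem_map.mp hu
    obtain ⟨x, hx, rfl⟩ := hroots r hr
    have h1 : (w / (x : ℂ)).re < 0 := by
      rw [Complex.div_ofReal_re]
      exact div_neg_of_pos_of_neg hw hx
    have h2 : ((x : ℂ) / w).re < 0 := by
      rw [← inv_div]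
      exact inv_re_neg h1
    rw [Complex.neg_re, Complex.add_re]
    linarith

lemma exists_sq_eq_re_pos {z : ℂ} (hz : z ∈ Complex.slitPlane) :
    ∃ w : ℂ, 0 < w.re ∧ w ^ 2 = z := by
  have hz0 := Complex.slitPlane_ne_zero hz
  refine ⟨Complex.exp (Complex.log z / 2), ?_, ?_⟩
  · rw [Complex.exp_re]
    apply mul_pos (Real.exp_pos _)
    have h1 := Complex.neg_pi_lt_arg z
    have h2 := (Complex.arg_le_pi z).lt_of_ne (Complex.mem_slitPlane_iff_arg.mp hz).1
    have h3 : (Complex.log z / 2).im = z.arg / 2 := by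
      rw [← Complex.log_im]
      simp
    rw [h3]
    apply Real.cos_pos_of_mem_Ioo
    constructor <;> linarith
  · rw [← Complex.exp_nat_mul]
    push_cast
    rw [mul_div_cancel₀ _ two_ne_zero, Complex.exp_log hz0]

end StanleyConjecture

open Polynomial StanleyConjecture in
/-- The Stanley–McNamara–Sagan–Fisk conjecture (Brändén's theorem): if the real polynomial
`∑_{k=0}^n a_k z^k` has all zeros real and negative (with `a_{-1} = a_{n+1} = 0`), then so
does `∑_{k=0}^n (a_k² - a_{k-1} a_{k+1}) z^k`. -/
theorem stanley_conjecture (n : ℕ) (a : ℤ → ℝ)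
    (ha : ∀ k : ℤ, (k < 0 ∨ (n : ℤ) < k) → a k = 0)
    (hroots : ∀ z : ℂ,
      (∑ k ∈ Finset.range (n + 1), (a (k : ℤ) : ℂ) * z ^ k) = 0 →
      ∃ x : ℝ, x < 0 ∧ z = (x : ℂ)) :
    ∀ z : ℂ,
      (∑ k ∈ Finset.range (n + 1),
          (((a (k : ℤ)) ^ 2 - a ((k : ℤ) - 1) * a ((k : ℤ) + 1) : ℝ) : ℂ) * z ^ k) = 0 →
      ∃ x : ℝ, x < 0 ∧ z = (x : ℂ) := by
  intro z hz
  set P : ℂ[X] := ∑ k ∈ Finset.range (n + 1), C (a (k : ℤ) : ℂ) * X ^ k with hPdef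
  have hcoeff : ∀ k : ℕ, P.coeff k = (a (k : ℤ) : ℂ) := by
    intro k
    rw [hPdef, finsetSum_coeff]
    simp only [coeff_C_mul_X_pow]
    rw [Finset.sum_ite_eq, ite_eq_left_iff]
    intro hk
    rw [ha k (Or.inr (by simp at hk; omega)), Complex.ofReal_zero]
  have heval : ∀ y : ℂ, P.eval y = 0 → ∃ x : ℝ, x < 0 ∧ y = (x : ℂ) := by
    intro y hy
    apply hroots
    simpa [hPdef, eval_finsetSum] using hy
  have hP0 : P.eval 0 ≠ 0 := by
    intro h
    obtain ⟨x, hx, h0⟩ := heval 0 h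
    exact hx.ne (Complex.ofReal_eq_zero.mp h0.symm)
  have hP : P ≠ 0 := by
    intro h
    exact hP0 (by rw [h, eval_zero])
  have hdeg : P.natDegree ≤ n :=
    natDegree_sum_le_of_forall_le _ _ fun k hk =>
      (natDegree_C_mul_X_pow_le _ _).trans (Nat.lt_succ_iff.mp (Finset.mem_range.mp hk))
  by_cases hslit : z ∈ Complex.slitPlane
  · exfalso
    obtain ⟨w, hw, rfl⟩ := exists_sq_eq_re_pos hslit
    refine sum_coeff_sq_sub_ne_zero hP (fun r hr => heval r (isRoot_of_mem_roots hr)) hw ?_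
    rw [← hz]
    have hlarge : ∀ k : ℕ, P.natDegree < k → (a (k : ℤ) : ℂ) = 0 := fun k hk => by
      rw [← hcoeff, coeff_eq_zero_of_natDegree_lt hk]
    have hsub : ∑ k ∈ Finset.range (P.natDegree + 1),
        (((a (k : ℤ)) ^ 2 - a ((k : ℤ) - 1) * a ((k : ℤ) + 1) : ℝ) : ℂ) * (w ^ 2) ^ k =
        ∑ k ∈ Finset.range (n + 1),
        (((a (k : ℤ)) ^ 2 - a ((k : ℤ) - 1) * a ((k : ℤ) + 1) : ℝ) : ℂ) * (w ^ 2) ^ k := by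
      apply Finset.sum_subset (Finset.range_subset_range.mpr (by omega))
      intro k _ hk
      rw [Finset.mem_range, not_lt] at hk
      have h1 := hlarge k (by omega)
      have h2 := hlarge (k + 1) (by omega)
      push_cast at h2 ⊢
      rw [h1, h2]
      ring
    have hshift : ∑ k ∈ Finset.range (P.natDegree + 1),
        (a ((k : ℤ) - 1) : ℂ) * a ((k : ℤ) + 1) * (w ^ 2) ^ k =
        ∑ k ∈ Finset.range (P.natDegree + 1),
          (P.coeff (k + 2) * w ^ (k + 2)) * (P.coeff k * w ^ k) := by
      rw [Finset.sum_range_succ', Finset.sum_range_succ _ P.natDegree,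
        coeff_eq_zero_of_natDegree_lt (n := P.natDegree + 2) (by omega),
        ha (((0 : ℕ) : ℤ) - 1) (Or.inl (by norm_num))]
      simp only [Complex.ofReal_zero, zero_mul, add_zero]
      refine Finset.sum_congr rfl fun k _ => ?_
      rw [hcoeff, hcoeff]
      push_cast
      rw [show (k : ℤ) + 1 - 1 = k by ring, show (k : ℤ) + 1 + 1 = k + 2 by ring]
      ring
    rw [← hsub, ← hshift, ← Finset.sum_sub_distrib]
    refine Finset.sum_congr rfl fun k _ => ?_
    rw [hcoeff]
    push_cast
    ring
  · rw [Complex.mem_slitPlane_iff, not_or, not_lt, not_not] at hslit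
    refine ⟨z.re, lt_of_le_of_ne hslit.1 fun h => ?_, Complex.ext rfl (by simp [hslit.2])⟩
    have hz0 : z = 0 := Complex.ext h hslit.2
    rw [hz0, Finset.sum_range_succ'] at hz
    simp only [zero_pow (Nat.succ_ne_zero _), mul_zero, Finset.sum_const_zero, zero_add,
      pow_zero, mul_one] at hz
    rw [ha (((0 : ℕ) : ℤ) - 1) (Or.inl (by norm_num)), zero_mul, sub_zero] at hz
    rw [← coeff_zero_eq_eval_zero, hcoeff] at hP0
    rw [Complex.ofReal_pow] at hz
    exact hP0 (eq_zero_of_pow_eq_zero hz)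
end

section
/- If the real polynomial φ(x) = ∑_{k=0}^{n} a_k x^k has all zeros real and negative (with a_k = 0 for k outside {0,...,n}), then for every positive integer p the polynomial ∑_{j=1}^{p} (-1)^{j+1} C(2p,p-j) * ( ∑_{k=0}^{n} (a_k^2 - a_{k-j} a_{k+j}) x^k ) has all zeros real and negative. -/
open Polynomial
open LaurentPolynomial (T)
open scoped LaurentPolynomial

namespace Polynomial

theorem eval_iterate_derivative_ne_zero_of_re_nonneg {P : ℂ[X]} {k : ℕ} (hk : k ≤ P.natDegree)
    (h : ∀ z : ℂ, 0 ≤ z.re → P.eval z ≠ 0) (z : ℂ) (hz : 0 ≤ z.re) :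
    (derivative^[k] P).eval z ≠ 0 := by
  induction k generalizing P with
  | zero => exact h z hz
  | succ k ih =>
    rw [Function.iterate_succ_apply]
    have hdeg : 0 < P.degree := natDegree_pos_iff_degree_pos.mp (by omega)
    have hP : P ≠ 0 := by rintro rfl; simp at hdeg
    have hP' : derivative P ≠ 0 := by
      intro h0
      have := derivative_eq_zero.mp h0
      omega
    refine ih ?_ fun w hw h0 => ?_
    · rw [natDegree_derivative]
      omega
    · have hmem : w ∈ P.derivative.rootSet ℂ := by
        rw [mem_rootSet, coe_aeval_eq_eval]
        exact ⟨hP', h0⟩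
      have hsub : convexHull ℝ (P.rootSet ℂ) ⊆ {u : ℂ | u.re < 0} := by
        refine convexHull_min (fun u hu => ?_) (convex_halfSpace_re_lt 0)
        rw [mem_rootSet, coe_aeval_eq_eval] at hu
        by_contra hn
        exact h u (not_lt.mp hn) hu.2
      exact absurd (hsub (rootSet_derivative_subset_convexHull_rootSet hdeg hmem)) (not_lt.mpr hw)

theorem coeff_ne_zero_of_re_nonneg {P : ℂ[X]} {k : ℕ} (hk : k ≤ P.natDegree)
    (h : ∀ z : ℂ, 0 ≤ z.re → P.eval z ≠ 0) : P.coeff k ≠ 0 := by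
  intro h0
  have := eval_iterate_derivative_ne_zero_of_re_nonneg hk h 0 le_rfl
  rw [← coeff_zero_eq_eval_zero, coeff_iterate_derivative] at this
  simp [h0] at this

theorem natDegree_one_add_C_mul_X_add_X_sq {c : ℂ} :
    (1 + C c * X + X ^ 2 : ℂ[X]).natDegree = 2 := by
  compute_degree!

theorem eval_one_add_C_mul_X_add_X_sq_ne_zero {c z : ℂ} (hc : 0 < c.re) (hz : 0 ≤ z.re) :
    (1 + C c * X + X ^ 2 : ℂ[X]).eval z ≠ 0 := by
  intro h
  have h' : 1 + c * z + z ^ 2 = 0 := by simpa using h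
  have hz0 : z ≠ 0 := by rintro rfl; simp at h'
  have hcz : c = -(z⁻¹ + z) := by
    field_simp
    linear_combination h'
  have h1 : 0 ≤ (z⁻¹).re := by
    rw [Complex.inv_re]
    exact div_nonneg hz (Complex.normSq_nonneg z)
  rw [hcz] at hc
  simp only [Complex.neg_re, Complex.add_re] at hc
  linarith

theorem coeff_quadratic_pow_ne_zero {c : ℂ} (hc : 0 < c.re) (n p : ℕ) :
    ((1 + C c * X + X ^ 2 : ℂ[X]) ^ (n + p)).coeff n ≠ 0 := by
  refine coeff_ne_zero_of_re_nonneg ?_ fun z hz => ?_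
  · rw [natDegree_pow, natDegree_one_add_C_mul_X_add_X_sq]
    omega
  · rw [eval_pow]
    exact pow_ne_zero _ (eval_one_add_C_mul_X_add_X_sq_ne_zero hc hz)

/-- Laguerre's theorem for the right half-plane: polar derivatives with respect to points of the
half-plane preserve nonvanishing there. -/
theorem polar_derivative_ne_zero {P : ℂ[X]} {n : ℕ} (hn : n ≠ 0) (hP : P.natDegree ≤ n)
    (h : ∀ z : ℂ, 0 < z.re → P.eval z ≠ 0) {c ζ : ℂ} (hc : 0 < c.re) (hζ : 0 < ζ.re) :
    n * P.eval c + (ζ - c) * P.derivative.eval c ≠ 0 := by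
  intro h0
  have hPc := h c hc
  set v := P.derivative.eval c / P.eval c with hv
  have hv0 : (n : ℂ) = (c - ζ) * v := by
    rw [hv]
    field_simp
    linear_combination h0
  have key : Complex.normSq v * c.re ≤ n * v.re := by
    have hsum : v = (P.roots.map fun x => 1 / (c - x)).sum :=
      (IsAlgClosed.splits P).eval_derivative_div_eval_of_ne_zero hPc
    have hroots : ∀ x ∈ P.roots, x.re ≤ 0 := fun x hx => by
      by_contra hn
      exact h x (not_le.mp hn) (isRoot_of_mem_roots hx)
    have hterm : ∀ x ∈ P.roots, Complex.normSq (1 / (c - x)) * c.re ≤ (1 / (c - x)).re := by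
      intro x hx
      have := hroots x hx
      have hne : 0 < Complex.normSq (c - x) := by
        rw [Complex.normSq_pos]
        intro h0
        have := congrArg Complex.re h0
        simp only [Complex.sub_re, Complex.zero_re] at this
        linarith
      rw [one_div, Complex.inv_re, map_inv₀, inv_mul_eq_div]
      refine div_le_div_of_nonneg_right ?_ hne.le
      rw [Complex.sub_re]
      linarith
    have hdisc : ∀ (w : ℂ) (s : Multiset ℂ), (∀ u ∈ s, Complex.normSq u * c.re ≤ u.re) →
        2 * (w.re * s.sum.re + w.im * s.sum.im) * c.re ≤
          s.sum.re + s.card * (Complex.normSq w * c.re) := by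
      intro w s
      induction s using Multiset.induction with
      | empty => simp
      | cons u s ih =>
        intro hs
        have h1 := hs u (Multiset.mem_cons_self u s)
        have h2 := ih fun w hw => hs w (Multiset.mem_cons_of_mem hw)
        rw [Multiset.sum_cons, Multiset.card_cons]
        simp only [Complex.add_re, Complex.add_im, Complex.normSq_apply] at *
        push_cast
        have h3 : 0 ≤ ((w.re - u.re) ^ 2 + (w.im - u.im) ^ 2) * c.re := by positivity
        linarith
    have h1 := hdisc (v / n) (P.roots.map fun x => 1 / (c - x)) (by
      intro u hu
      obtain ⟨x, hx, rfl⟩ := Multiset.mem_map.mp hu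
      exact hterm x hx)
    rw [← hsum, Multiset.card_map] at h1
    have h2 : (P.roots.card : ℝ) * (Complex.normSq (v / n) * c.re) ≤
        n * (Complex.normSq (v / n) * c.re) := by
      have := Complex.normSq_nonneg (v / n)
      gcongr
      exact (card_roots' P).trans hP
    have hn' : (n : ℝ) ≠ 0 := by exact_mod_cast hn
    have h3 : (n : ℝ) * (Complex.normSq (v / n) * c.re) = Complex.normSq v * c.re / n := by
      rw [map_div₀, Complex.normSq_natCast]
      field_simp
    have h4 : 2 * ((v / n).re * v.re + (v / n).im * v.im) * c.re =
        2 * (Complex.normSq v * c.re / n) := by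
      rw [Complex.div_natCast_re, Complex.div_natCast_im, Complex.normSq_apply]
      ring
    have h5 : Complex.normSq v * c.re / n ≤ v.re := by linarith
    rwa [div_le_iff₀' (by positivity)] at h5
  have hn' : (0 : ℝ) < n := by positivity
  have hvne : 0 < Complex.normSq v := by
    rw [Complex.normSq_pos]
    rintro h
    rw [h, mul_zero] at hv0
    exact hn (by exact_mod_cast hv0)
  have : (n : ℝ) * v.re = (c - ζ).re * Complex.normSq v := by
    have := congrArg Complex.re (congrArg (· * (starRingEnd ℂ) v) hv0)
    simp only [mul_assoc, Complex.mul_conj] at this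
    simpa using this
  simp only [Complex.sub_re] at this
  nlinarith

/-- The constant term of a Laurent polynomial. -/
noncomputable def constTerm : ℂ[T;T⁻¹] →ₗ[ℂ] ℂ :=
  Finsupp.lapply 0 ∘ₗ (AddMonoidAlgebra.coeffLinearEquiv ℂ).toLinearMap

theorem constTerm_T (m : ℤ) : constTerm (T m) = if m = 0 then 1 else 0 := by
  simp [constTerm]

/-- The constant term of `(4 - s ^ 2) ^ p * G(s)` at `s = T + T⁻¹`; up to a scalar, this integrates
`G` against the ultraspherical weight `(4 - s ^ 2) ^ (p - 1/2)` on `[-2, 2]`. -/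
noncomputable def ultrasphericalFunctional (p : ℕ) : ℂ[X] →ₗ[ℂ] ℂ :=
  constTerm ∘ₗ LinearMap.mulLeft ℂ ((4 - (T 1 + T (-1)) ^ 2) ^ p) ∘ₗ
    (aeval (T 1 + T (-1) : ℂ[T;T⁻¹])).toLinearMap

theorem ultrasphericalFunctional_apply (p : ℕ) (G : ℂ[X]) :
    ultrasphericalFunctional p G =
      constTerm ((4 - (T 1 + T (-1)) ^ 2) ^ p * aeval (T 1 + T (-1) : ℂ[T;T⁻¹]) G) := rfl

theorem ultrasphericalFunctional_succ (p : ℕ) (G : ℂ[X]) :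
    ultrasphericalFunctional (p + 1) G =
      4 * ultrasphericalFunctional p G - ultrasphericalFunctional p (X ^ 2 * G) := by
  have : (4 : ℂ) * ultrasphericalFunctional p G = ultrasphericalFunctional p ((4 : ℂ[X]) * G) := by
    rw [← smul_eq_mul, ← map_smul, smul_eq_C_mul]
    rfl
  rw [this, ← map_sub, ultrasphericalFunctional_apply, ultrasphericalFunctional_apply]
  congr 1
  simp only [map_sub, map_mul, map_pow, aeval_X, map_ofNat]
  ring

theorem ultrasphericalFunctional_zero_X_pow (m : ℕ) :
    ultrasphericalFunctional 0 (X ^ m) = if Even m then (m.choose (m / 2) : ℂ) else 0 := by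
  rw [ultrasphericalFunctional_apply, pow_zero, one_mul, map_pow, aeval_X, add_pow, map_sum]
  have : ∀ k ∈ Finset.range (m + 1), constTerm (T 1 ^ k * T (-1) ^ (m - k) * (m.choose k : ℂ[T;T⁻¹])) =
      if 2 * k = m then (m.choose k : ℂ) else 0 := by
    intro k hk
    rw [Finset.mem_range] at hk
    rw [LaurentPolynomial.T_pow, LaurentPolynomial.T_pow, ← LaurentPolynomial.T_add, mul_comm, ← nsmul_eq_mul, map_nsmul, constTerm_T, nsmul_eq_mul]
    by_cases h : 2 * k = m
    · rw [if_pos (by omega), if_pos h, mul_one]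
    · rw [if_neg (by omega), if_neg h, mul_zero]
  rw [Finset.sum_congr rfl this]
  split_ifs with h
  · obtain ⟨i, rfl⟩ := h
    rw [Finset.sum_eq_single i]
    · rw [if_pos (by omega)]
      congr
      omega
    · intro k _ hk
      exact if_neg (by omega)
    · intro hi
      simp at hi
  · refine Finset.sum_eq_zero fun k _ => if_neg fun hk => h ⟨k, by omega⟩

theorem ultrasphericalFunctional_X_pow_odd (p : ℕ) {m : ℕ} (hm : ¬ Even m) :
    ultrasphericalFunctional p (X ^ m) = 0 := by
  induction p generalizing m with
  | zero => rw [ultrasphericalFunctional_zero_X_pow, if_neg hm]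
  | succ p ih =>
    rw [ultrasphericalFunctional_succ, ← pow_add, ih hm, ih (by grind)]
    simp

theorem ultrasphericalFunctional_X_pow_even (p i : ℕ) :
    ultrasphericalFunctional p (X ^ (2 * i)) =
      ((2 * p).factorial * (2 * i).factorial : ℂ) /
        (p.factorial * i.factorial * (p + i).factorial) := by
  induction p generalizing i with
  | zero =>
    rw [ultrasphericalFunctional_zero_X_pow, if_pos (by simp), Nat.cast_choose ℂ (by omega)]
    rw [show 2 * i / 2 = i by omega, show 2 * i - i = i by omega]
    simp
  | succ p ih =>
    rw [ultrasphericalFunctional_succ, ← pow_add, show 2 + 2 * i = 2 * (i + 1) by ring, ih, ih]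
    rw [show 2 * (i + 1) = 2 * i + 1 + 1 by ring, show 2 * (p + 1) = 2 * p + 1 + 1 by ring,
      show p + 1 + i = p + i + 1 by ring, ← add_assoc]
    simp only [Nat.factorial_succ]
    have h1 : (p.factorial : ℂ) ≠ 0 := by exact_mod_cast p.factorial_ne_zero
    have h2 : (i.factorial : ℂ) ≠ 0 := by exact_mod_cast i.factorial_ne_zero
    have h3 : ((p + i).factorial : ℂ) ≠ 0 := by exact_mod_cast (p + i).factorial_ne_zero
    have h4 : (p + i + 1 : ℂ) ≠ 0 := by exact_mod_cast (p + i).succ_ne_zero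
    have h5 : (p + 1 : ℂ) ≠ 0 := by exact_mod_cast p.succ_ne_zero
    have h6 : (i + 1 : ℂ) ≠ 0 := by exact_mod_cast i.succ_ne_zero
    push_cast
    field_simp
    ring

theorem coeff_one_add_X_sq_pow (m q : ℕ) :
    ((1 + X ^ 2 : ℂ[X]) ^ m).coeff q = if Even q then (m.choose (q / 2) : ℂ) else 0 := by
  have : (1 + X ^ 2 : ℂ[X]) ^ m = expand ℂ 2 ((1 + X) ^ m) := by simp
  rw [this, coeff_expand two_pos, coeff_one_add_X_pow]
  simp only [even_iff_two_dvd]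

theorem ultrasphericalFunctional_X_add_C_pow (p n : ℕ) (c : ℂ) :
    ultrasphericalFunctional p ((X + C c) ^ n) =
      ((2 * p).factorial * n.factorial : ℂ) / (p.factorial * (n + p).factorial) *
        ((1 + C c * X + X ^ 2 : ℂ[X]) ^ (n + p)).coeff n := by
  have h1 : (1 + C c * X + X ^ 2 : ℂ[X]) ^ (n + p) =
      ∑ m ∈ Finset.range (n + p + 1), C (c ^ (n + p - m) * ((n + p).choose m : ℂ)) *
        ((1 + X ^ 2) ^ m * X ^ (n + p - m)) := by
    rw [show (1 + C c * X + X ^ 2 : ℂ[X]) = (1 + X ^ 2) + C c * X by ring, add_pow]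
    refine Finset.sum_congr rfl fun m _ => ?_
    simp only [map_mul, map_pow, map_natCast]
    ring
  rw [h1, finsetSum_coeff, add_pow, map_sum, show n + p + 1 = p + (n + 1) by ring,
    Finset.sum_range_add _ p, Finset.sum_eq_zero (s := Finset.range p), zero_add, Finset.mul_sum]
  · refine Finset.sum_congr rfl fun q hq => ?_
    rw [Finset.mem_range] at hq
    have h2 : (X ^ q * C c ^ (n - q) * (n.choose q : ℂ[X])) =
        (c ^ (n - q) * n.choose q : ℂ) • X ^ q := by
      rw [smul_eq_C_mul]
      simp only [map_mul, map_pow, map_natCast]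
      ring
    rw [h2, map_smul, smul_eq_mul, coeff_C_mul, coeff_mul_X_pow', if_pos (by omega),
      show n - (n + p - (p + q)) = q by omega, show n + p - (p + q) = n - q by omega,
      coeff_one_add_X_sq_pow]
    split_ifs with h
    · obtain ⟨i, rfl⟩ := h
      rw [← two_mul] at *
      rw [ultrasphericalFunctional_X_pow_even, show 2 * i / 2 = i by omega,
        Nat.cast_choose ℂ (by omega : 2 * i ≤ n), Nat.cast_choose ℂ (by omega : p + 2 * i ≤ n + p),
        Nat.cast_choose ℂ (by omega : i ≤ p + 2 * i), show n + p - (p + 2 * i) = n - 2 * i by omega,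
        show p + 2 * i - i = p + i by omega]
      have h0 : ∀ k : ℕ, (k.factorial : ℂ) ≠ 0 := fun k => by exact_mod_cast k.factorial_ne_zero
      have := h0 (n + p)
      have := h0 (p + 2 * i)
      have := h0 (2 * i)
      field_simp
    · rw [ultrasphericalFunctional_X_pow_odd p h]
      simp
  · intro m hm
    rw [Finset.mem_range] at hm
    rw [coeff_C_mul, coeff_mul_X_pow', if_neg (by omega), mul_zero]

/-- The induction step of the Grace-Walsh-Szegő theorem for the right half-plane: one of the
coinciding arguments may be moved freely in the half-plane. -/
theorem linearMap_mul_X_add_C_pow_mul_X_add_C_ne_zero (L : ℂ[X] →ₗ[ℂ] ℂ) (R : ℂ[X]) (m : ℕ)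
    (h : ∀ c : ℂ, 0 < c.re → L (R * (X + C c) ^ (m + 1)) ≠ 0) {c ζ : ℂ} (hc : 0 < c.re)
    (hζ : 0 < ζ.re) : L (R * (X + C c) ^ m * (X + C ζ)) ≠ 0 := by
  have hexp : ∀ (n : ℕ) (b : ℂ), L (R * (X + C b) ^ n) =
      ∑ k ∈ Finset.range (n + 1), b ^ k * n.choose k * L (R * X ^ (n - k)) := by
    intro n b
    rw [add_comm X, add_pow, Finset.mul_sum, map_sum]
    refine Finset.sum_congr rfl fun k _ => ?_
    rw [← smul_eq_mul (b ^ k * (n.choose k : ℂ)), ← map_smul, smul_eq_C_mul]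
    congr 1
    simp only [map_mul, map_pow, map_natCast]
    ring
  set P : ℂ[X] := ∑ k ∈ Finset.range (m + 1 + 1),
    C ((m + 1).choose k * L (R * X ^ (m + 1 - k))) * X ^ k with hPdef
  have heval : ∀ b : ℂ, P.eval b = L (R * (X + C b) ^ (m + 1)) := by
    intro b
    rw [hexp, hPdef, eval_finsetSum]
    refine Finset.sum_congr rfl fun k _ => ?_
    simp only [eval_mul, eval_C, eval_pow, eval_X]
    ring
  have hderiv : P.derivative.eval c = (m + 1) * L (R * (X + C c) ^ m) := by
    rw [hexp, hPdef, derivative_sum, eval_finsetSum, Finset.sum_range_succ', Finset.mul_sum]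
    simp only [pow_zero, mul_one, derivative_C, eval_zero, add_zero]
    refine Finset.sum_congr rfl fun k _ => ?_
    have := congrArg (Nat.cast (R := ℂ)) (Nat.add_one_mul_choose_eq m k)
    push_cast at this
    rw [derivative_C_mul_X_pow, Nat.add_sub_add_right, Nat.add_sub_cancel]
    simp only [eval_mul, eval_C, eval_pow, eval_X]
    push_cast
    linear_combination -(L (R * X ^ (m - k)) * c ^ k) * this
  have hdeg : P.natDegree ≤ m + 1 := natDegree_sum_le_of_forall_le _ _ fun k hk =>
    (natDegree_C_mul_X_pow_le _ _).trans (by rw [Finset.mem_range] at hk; omega)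
  have key := polar_derivative_ne_zero (Nat.succ_ne_zero m) hdeg
    (fun b hb => (heval b).symm ▸ h b hb) hc hζ
  intro h0
  apply key
  have hsplit : R * (X + C c) ^ m * (X + C ζ) =
      R * (X + C c) ^ (m + 1) + (ζ - c) • (R * (X + C c) ^ m) := by
    rw [smul_eq_C_mul, C_sub]
    ring
  rw [hsplit, map_add, map_smul, smul_eq_mul] at h0
  rw [heval, hderiv]
  push_cast
  linear_combination (m + 1 : ℂ) * h0

theorem ultrasphericalFunctional_prod_mul_pow_ne_zero (p : ℕ) (s : Multiset ℂ)
    (hs : ∀ b ∈ s, 0 < b.re) (m : ℕ) {c : ℂ} (hc : 0 < c.re) :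
    ultrasphericalFunctional p ((s.map fun b => X + C b).prod * (X + C c) ^ m) ≠ 0 := by
  induction s using Multiset.induction generalizing m c with
  | empty =>
    rw [Multiset.map_zero, Multiset.prod_zero, one_mul, ultrasphericalFunctional_X_add_C_pow]
    refine mul_ne_zero ?_ (coeff_quadratic_pow_ne_zero hc m p)
    have h0 : ∀ k : ℕ, (k.factorial : ℂ) ≠ 0 := fun k => by exact_mod_cast k.factorial_ne_zero
    exact div_ne_zero (mul_ne_zero (h0 _) (h0 _)) (mul_ne_zero (h0 _) (h0 _))
  | cons ζ s ih =>
    have := linearMap_mul_X_add_C_pow_mul_X_add_C_ne_zero (ultrasphericalFunctional p)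
      (s.map fun b => X + C b).prod m
      (fun b hb => ih (fun u hu => hs u (Multiset.mem_cons_of_mem hu)) (m + 1) hb) hc
      (hs ζ (Multiset.mem_cons_self ζ s))
    rw [Multiset.map_cons, Multiset.prod_cons]
    convert this using 2
    ring

theorem ultrasphericalFunctional_prod_ne_zero (p : ℕ) (s : Multiset ℂ)
    (hs : ∀ b ∈ s, 0 < b.re) :
    ultrasphericalFunctional p (s.map fun b => X + C b).prod ≠ 0 := by
  simpa using ultrasphericalFunctional_prod_mul_pow_ne_zero p s hs 0 (c := 1) (by simp)

theorem four_sub_sq_pow (p : ℕ) :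
    (4 - (T 1 + T (-1) : ℂ[T;T⁻¹]) ^ 2) ^ p =
      ∑ l ∈ Finset.range (2 * p + 1),
        ((-1) ^ (p + l) * (2 * p).choose l : ℂ) • T (2 * l - 2 * p) := by
  have hT : (T 1 * T (-1) : ℂ[T;T⁻¹]) = 1 := by rw [← LaurentPolynomial.T_add]; simp
  have h : (4 - (T 1 + T (-1) : ℂ[T;T⁻¹]) ^ 2) = -(T 1 + -T (-1)) ^ 2 := by
    linear_combination -4 * hT
  rw [h, neg_pow, ← pow_mul, add_pow, Finset.mul_sum]
  refine Finset.sum_congr rfl fun l hl => ?_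
  rw [Finset.mem_range] at hl
  have hpar : (-1 : ℂ[T;T⁻¹]) ^ (2 * p - l) = (-1) ^ l := by
    rcases Nat.even_or_odd l with h | h
    · rw [h.neg_one_pow, Even.neg_one_pow (by grind)]
    · rw [h.neg_one_pow, Odd.neg_one_pow (by grind)]
  rw [neg_pow (T (-1) : ℂ[T;T⁻¹]), hpar, LaurentPolynomial.T_pow, LaurentPolynomial.T_pow,
    Algebra.smul_def, show (2 * l - 2 * p : ℤ) = l * 1 + (2 * p - l : ℕ) * -1 by omega,
    LaurentPolynomial.T_add]
  simp only [map_mul, map_pow, map_neg, map_one, map_natCast]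
  ring

theorem aeval_smul_T_mul_aeval_smul_T (s : Multiset ℂ) {w : ℂ} (hw : w ≠ 0) (hs : (0 : ℂ) ∉ s) :
    aeval (w • T 1 : ℂ[T;T⁻¹]) (s.map fun b => X - C b).prod *
        aeval (w • T (-1) : ℂ[T;T⁻¹]) (s.map fun b => X - C b).prod =
      (s.map fun b => -b * w).prod • aeval (T 1 + T (-1) : ℂ[T;T⁻¹])
        ((s.map fun b => w / -b + -b / w).map fun b => X + C b).prod := by
  have hT : (T 1 * T (-1) : ℂ[T;T⁻¹]) = 1 := by rw [← LaurentPolynomial.T_add]; simp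
  induction s using Multiset.induction with
  | empty => simp
  | cons b s ih =>
    rw [Multiset.mem_cons, not_or] at hs
    have hb : b ≠ 0 := Ne.symm hs.1
    simp only [Multiset.map_cons, Multiset.prod_cons, map_mul]
    rw [mul_mul_mul_comm, ih hs.2, ← smul_mul_smul_comm]
    congr 1
    simp only [map_sub, map_add, aeval_X, aeval_C, Algebra.smul_def]
    have h1 : (w / -b + -b / w) * (-b * w) = w ^ 2 + b ^ 2 := by
      field_simp
      ring
    have h2 := congrArg (algebraMap ℂ ℂ[T;T⁻¹]) h1
    simp only [map_mul, map_add, map_pow, map_neg] at h2 ⊢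
    linear_combination (algebraMap ℂ ℂ[T;T⁻¹] w) ^ 2 * hT - h2

theorem constTerm_T_mul_sum_mul_sum (n : ℕ) (a : ℤ → ℂ)
    (ha : ∀ k : ℤ, (k < 0 ∨ (n : ℤ) < k) → a k = 0) (w : ℂ) (j : ℤ) :
    constTerm (T (-2 * j) * ((∑ k ∈ Finset.range (n + 1), (a k * w ^ k) • T k) *
        ∑ k ∈ Finset.range (n + 1), (a k * w ^ k) • T (-k))) =
      ∑ k ∈ Finset.range (n + 1), a (k - j) * a (k + j) * (w ^ 2) ^ k := by
  have hterm : T (-2 * j) * ((∑ k ∈ Finset.range (n + 1), (a k * w ^ k) • T k) *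
        ∑ k ∈ Finset.range (n + 1), (a k * w ^ k) • T (-k)) =
      ∑ q ∈ Finset.range (n + 1) ×ˢ Finset.range (n + 1),
        (a q.1 * a q.2 * w ^ (q.1 + q.2)) • (T (q.1 - q.2 - 2 * j) : ℂ[T;T⁻¹]) := by
    rw [Finset.sum_mul_sum, ← Finset.sum_product', Finset.mul_sum]
    refine Finset.sum_congr rfl fun q _ => ?_
    rw [show (q.1 - q.2 - 2 * j : ℤ) = -2 * j + (q.1 + -q.2) by ring, LaurentPolynomial.T_add,
      LaurentPolynomial.T_add, smul_mul_smul_comm, mul_smul_comm]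
    congr 1
    ring
  rw [hterm, map_sum]
  simp only [map_smul, constTerm_T, smul_eq_mul]
  symm
  refine Finset.sum_bij_ne_zero (fun k _ _ => ((k + j : ℤ).toNat, (k - j : ℤ).toNat)) ?_ ?_ ?_ ?_
  · intro k hk hne
    have h1 : a (k - j) ≠ 0 := fun h => hne (by simp [h])
    have h2 : a (k + j) ≠ 0 := fun h => hne (by simp [h])
    have h3 := mt (ha _) h1
    have h4 := mt (ha _) h2
    simp only [Finset.mem_product, Finset.mem_range]
    omega
  · intro k hk hne k' hk' hne' h
    have h1 : a (k - j) ≠ 0 := fun h => hne (by simp [h])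
    have h2 : a (k + j) ≠ 0 := fun h => hne (by simp [h])
    have h3 := mt (ha _) h1
    have h4 := mt (ha _) h2
    have h1' : a (k' - j) ≠ 0 := fun h => hne' (by simp [h])
    have h2' : a (k' + j) ≠ 0 := fun h => hne' (by simp [h])
    have h3' := mt (ha _) h1'
    have h4' := mt (ha _) h2'
    simp only [Prod.mk.injEq] at h
    omega
  · rintro ⟨u, v⟩ hq hne
    simp only [Finset.mem_product, Finset.mem_range] at hq
    have huv : (u - v - 2 * j : ℤ) = 0 := by
      by_contra h
      exact hne (by simp [h])
    refine ⟨((v + j : ℤ)).toNat, ?_, ?_, ?_⟩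
    · rw [Finset.mem_range]
      omega
    · have e1 : (((v + j : ℤ).toNat : ℤ) - j) = v := by omega
      have e2 : (((v + j : ℤ).toNat : ℤ) + j) = u := by omega
      have e3 : u + v = 2 * (v + j : ℤ).toNat := by omega
      rw [e1, e2, ← pow_mul, ← e3, mul_comm (a v)]
      simpa [huv] using hne
    · ext <;> simp only <;> omega
  · intro k hk hne
    have h1 : a (k - j) ≠ 0 := fun h => hne (by simp [h])
    have h2 : a (k + j) ≠ 0 := fun h => hne (by simp [h])
    have h3 := mt (ha _) h1
    have h4 := mt (ha _) h2
    have e1 : ((k - j : ℤ).toNat : ℤ) = k - j := by omega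
    have e2 : ((k + j : ℤ).toNat : ℤ) = k + j := by omega
    have e3 : (k + j : ℤ).toNat + (k - j : ℤ).toNat = 2 * k := by omega
    simp only [e1, e2, e3, ← pow_mul]
    rw [if_pos (by ring)]
    ring

theorem sum_range_neg_one_pow_mul_choose_mul (B : ℤ → ℂ) (hB : ∀ j, B (-j) = B j) {p : ℕ}
    (hp : 0 < p) :
    ∑ l ∈ Finset.range (2 * p + 1), ((-1) ^ (p + l) * (2 * p).choose l : ℂ) * B (p - l) =
      2 * ∑ j ∈ Finset.Icc 1 p, ((-1) ^ (j + 1) * (2 * p).choose (p - j) : ℂ) * (B 0 - B j) := by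
  have halt : ∑ l ∈ Finset.range (2 * p + 1), ((-1) ^ (p + l) * (2 * p).choose l : ℂ) = 0 := by
    have h := congrArg (Int.cast (R := ℂ)) (Int.alternating_sum_range_choose (n := 2 * p))
    rw [if_neg (by omega)] at h
    push_cast at h
    simp only [pow_add, mul_assoc, ← Finset.mul_sum, h, mul_zero]
  have hsub : ∑ l ∈ Finset.range (2 * p + 1), ((-1) ^ (p + l) * (2 * p).choose l : ℂ) * B (p - l) =
      ∑ l ∈ Finset.range (2 * p + 1),
        ((-1) ^ (p + l) * (2 * p).choose l : ℂ) * (B (p - l) - B 0) := by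
    simp only [mul_sub, Finset.sum_sub_distrib, ← Finset.sum_mul, halt, zero_mul, sub_zero]
  rw [hsub, show 2 * p + 1 = p + 1 + p by ring, Finset.sum_range_add, Finset.sum_range_succ,
    sub_self, sub_self, mul_zero, add_zero, ← Finset.sum_range_reflect,
    show Finset.Icc 1 p = Finset.Ico 1 (p + 1) from rfl, Finset.sum_Ico_eq_sum_range,
    Nat.add_sub_cancel, ← Finset.sum_add_distrib, Finset.mul_sum]
  refine Finset.sum_congr rfl fun q hq => ?_
  rw [Finset.mem_range] at hq
  have e1 : (p : ℤ) - (p - 1 - q : ℕ) = (1 + q : ℕ) := by omega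
  have e2 : (p : ℤ) - (p + 1 + q : ℕ) = -(1 + q : ℕ) := by omega
  have e3 : (2 * p).choose (p + 1 + q) = (2 * p).choose (p - (1 + q)) := by
    rw [← Nat.choose_symm (by omega)]
    congr 1
    omega
  have e4 : p - 1 - q = p - (1 + q) := by omega
  have e5 : (-1 : ℂ) ^ (p + (p - (1 + q))) = (-1) ^ (1 + q) := by
    rcases Nat.even_or_odd (1 + q) with h | h
    · rw [h.neg_one_pow, Even.neg_one_pow (by grind)]
    · rw [h.neg_one_pow, Odd.neg_one_pow (by grind)]
  have e6 : (-1 : ℂ) ^ (p + (p + 1 + q)) = (-1) ^ (1 + q) := by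
    rw [show p + (p + 1 + q) = 2 * p + (1 + q) by ring, pow_add, pow_mul]
    simp
  rw [e1, e2, hB, e3, e6, e4, e5]
  ring

theorem exists_sq_eq_re_pos {z : ℂ} (hz : ¬ ∃ x : ℝ, x ≤ 0 ∧ z = x) :
    ∃ w : ℂ, w ^ 2 = z ∧ 0 < w.re := by
  obtain ⟨w, hw⟩ := IsAlgClosed.exists_pow_nat_eq z two_pos
  rcases lt_trichotomy w.re 0 with h | h | h
  · exact ⟨-w, by rw [neg_sq, hw], by simpa using h⟩
  · refine absurd ⟨-w.im ^ 2, by simpa using sq_nonneg w.im, ?_⟩ hz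
    rw [← hw, ← Complex.re_add_im w, h]
    simp [mul_pow]
  · exact ⟨w, hw, h⟩

theorem constTerm_four_sub_sq_pow_mul (n : ℕ) (a : ℤ → ℂ)
    (ha : ∀ k : ℤ, (k < 0 ∨ (n : ℤ) < k) → a k = 0) (w : ℂ) {p : ℕ} (hp : 0 < p) :
    constTerm ((4 - (T 1 + T (-1)) ^ 2) ^ p *
      ((∑ k ∈ Finset.range (n + 1), (a k * w ^ k) • T k) *
        ∑ k ∈ Finset.range (n + 1), (a k * w ^ k) • T (-k))) =
      2 * ∑ j ∈ Finset.Icc 1 p, ((-1) ^ (j + 1) * (2 * p).choose (p - j) : ℂ) *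
        ∑ k ∈ Finset.range (n + 1), (a k ^ 2 - a (k - j) * a (k + j)) * (w ^ 2) ^ k := by
  have h := sum_range_neg_one_pow_mul_choose_mul
    (fun j => ∑ k ∈ Finset.range (n + 1), a (k - j) * a (k + j) * (w ^ 2) ^ k) (fun j => by
      refine Finset.sum_congr rfl fun k _ => ?_
      rw [sub_neg_eq_add, ← sub_eq_add_neg, mul_comm (a _)]) hp
  simp only [← Finset.sum_sub_distrib, ← sub_mul, sub_zero, add_zero, ← sq (a _)] at h
  rw [← h, four_sub_sq_pow, Finset.sum_mul, map_sum]
  refine Finset.sum_congr rfl fun l _ => ?_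
  rw [smul_mul_assoc, map_smul, smul_eq_mul, ← constTerm_T_mul_sum_mul_sum n a ha,
    show (2 * l - 2 * p : ℤ) = -2 * (p - l) by ring]

theorem constTerm_mul_aeval_mul_aeval_ne_zero (p : ℕ) {f : ℂ[X]} (hf : f ≠ 0)
    (hroots : ∀ b : ℂ, f.eval b = 0 → ∃ x : ℝ, x < 0 ∧ b = x) {w : ℂ} (hw : 0 < w.re) :
    constTerm ((4 - (T 1 + T (-1)) ^ 2) ^ p *
      (aeval (w • T 1 : ℂ[T;T⁻¹]) f * aeval (w • T (-1) : ℂ[T;T⁻¹]) f)) ≠ 0 := by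
  have hw0 : w ≠ 0 := by rintro rfl; simp at hw
  have hneg : ∀ b ∈ f.roots, ∃ x : ℝ, x < 0 ∧ b = x := fun b hb =>
    hroots b (isRoot_of_mem_roots hb)
  have h0 : (0 : ℂ) ∉ f.roots := fun h => by
    obtain ⟨x, hx, h⟩ := hneg 0 h
    exact hx.ne' (by exact_mod_cast h)
  have hfac : f = f.leadingCoeff • (f.roots.map fun b => X - C b).prod := by
    rw [smul_eq_C_mul]
    exact (IsAlgClosed.splits f).eq_prod_roots
  have hprod : aeval (w • T 1 : ℂ[T;T⁻¹]) f * aeval (w • T (-1) : ℂ[T;T⁻¹]) f =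
      (f.leadingCoeff * f.leadingCoeff * (f.roots.map fun b => -b * w).prod) •
        aeval (T 1 + T (-1) : ℂ[T;T⁻¹])
          ((f.roots.map fun b => w / -b + -b / w).map fun b => X + C b).prod := by
    conv_lhs => rw [hfac, map_smul, map_smul, smul_mul_smul_comm,
      aeval_smul_T_mul_aeval_smul_T _ hw0 h0, ← mul_smul]
  rw [hprod, mul_smul_comm, map_smul, smul_eq_mul, ← ultrasphericalFunctional_apply]
  have hlead : f.leadingCoeff ≠ 0 := leadingCoeff_ne_zero.mpr hf
  refine mul_ne_zero (mul_ne_zero (mul_ne_zero hlead hlead) ?_)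
    (ultrasphericalFunctional_prod_ne_zero p _ ?_)
  · refine Multiset.prod_ne_zero fun h => ?_
    obtain ⟨b, hb, h⟩ := Multiset.mem_map.mp h
    rcases mul_eq_zero.mp h with h | h
    · exact h0 (neg_eq_zero.mp h ▸ hb)
    · exact hw0 h
  · intro u hu
    obtain ⟨b, hb, rfl⟩ := Multiset.mem_map.mp hu
    obtain ⟨x, hx, rfl⟩ := hneg b hb
    have hwsq : 0 < Complex.normSq w := Complex.normSq_pos.mpr hw0
    rw [← Complex.ofReal_neg, Complex.add_re, Complex.div_ofReal_re, div_eq_mul_inv (_ : ℂ) w,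
      Complex.re_ofReal_mul, Complex.inv_re]
    have : 0 < -x := by linarith
    positivity

end Polynomial


/-- If `∑_{k=0}^n a_k x^k` has all zeros real and negative, then for every positive integer `p`
the polynomial `∑_{j=1}^p (-1)^{j+1} C(2p,p-j) (∑_{k=0}^n (a_k² - a_{k-j}a_{k+j}) x^k)` has all
zeros real and negative. -/
theorem fisk_combination_real_negative_zeros (n : ℕ) (a : ℤ → ℝ)
    (ha : ∀ k : ℤ, (k < 0 ∨ (n : ℤ) < k) → a k = 0)
    (hroots : ∀ z : ℂ,
      (∑ k ∈ Finset.range (n + 1), (a (k : ℤ) : ℂ) * z ^ k) = 0 →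
      ∃ x : ℝ, x < 0 ∧ z = (x : ℂ)) (p : ℕ) (hp : 0 < p) :
    ∀ z : ℂ,
      (∑ j ∈ Finset.Icc 1 p,
          ((-1 : ℂ) ^ (j + 1) * ((2 * p).choose (p - j) : ℂ)) *
            ∑ k ∈ Finset.range (n + 1),
              (((a (k : ℤ)) ^ 2 - a ((k : ℤ) - j) * a ((k : ℤ) + j) : ℝ) : ℂ) * z ^ k) = 0 →
      ∃ x : ℝ, x < 0 ∧ z = (x : ℂ) := by
  intro z hz
  by_contra hneg
  have ha' : ∀ k : ℤ, (k < 0 ∨ (n : ℤ) < k) → (a k : ℂ) = 0 := fun k hk => by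
    rw [ha k hk, Complex.ofReal_zero]
  have ha0 : (a 0 : ℂ) ≠ 0 := by
    intro h
    obtain ⟨x, hx, hx0⟩ := hroots 0 (by simp [Finset.sum_range_succ', h])
    exact hx.ne' (by exact_mod_cast hx0)
  have hvanish : ∀ w : ℂ, w ^ 2 = z → constTerm ((4 - (T 1 + T (-1)) ^ 2) ^ p *
      ((∑ k ∈ Finset.range (n + 1), ((a k : ℂ) * w ^ k) • T k) *
        ∑ k ∈ Finset.range (n + 1), ((a k : ℂ) * w ^ k) • T (-k))) = 0 := by
    rintro w rfl
    rw [constTerm_four_sub_sq_pow_mul n _ ha' w hp]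
    push_cast at hz
    rw [hz, mul_zero]
  by_cases hz0 : z = 0
  · have h := hvanish 0 (by simp [hz0])
    simp only [Finset.sum_range_succ', zero_pow (Nat.add_one_ne_zero _), mul_zero, zero_smul, Finset.sum_const_zero,
      zero_add, pow_zero, mul_one, Nat.cast_zero, neg_zero, LaurentPolynomial.T_zero,
      mul_smul_comm, map_smul, smul_eq_mul] at h
    have h1 := ultrasphericalFunctional_prod_ne_zero p 0 (by simp)
    rw [Multiset.map_zero, Multiset.prod_zero, ultrasphericalFunctional_apply, map_one,
      mul_one] at h1
    exact mul_ne_zero ha0 (mul_ne_zero ha0 h1) h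
  · obtain ⟨w, hw, hre⟩ := exists_sq_eq_re_pos (z := z) (by
      rintro ⟨x, hx, rfl⟩
      exact hneg ⟨x, lt_of_le_of_ne hx (by exact_mod_cast hz0), rfl⟩)
    set f : ℂ[X] := ∑ k ∈ Finset.range (n + 1), C (a k : ℂ) * X ^ k with hf
    have heval : ∀ b : ℂ, f.eval b = ∑ k ∈ Finset.range (n + 1), (a k : ℂ) * b ^ k := by
      intro b
      simp [hf, eval_finsetSum]
    have hf0 : f ≠ 0 := by
      intro h
      have := heval 0
      rw [h, eval_zero] at this
      exact ha0 (by simpa [Finset.sum_range_succ'] using this.symm)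
    have haeval : ∀ i : ℤ, aeval (w • T i : ℂ[T;T⁻¹]) f =
        ∑ k ∈ Finset.range (n + 1), ((a k : ℂ) * w ^ k) • T (k * i) := by
      intro i
      rw [hf, map_sum]
      refine Finset.sum_congr rfl fun k _ => ?_
      rw [map_mul, aeval_C, map_pow, aeval_X, _root_.smul_pow, LaurentPolynomial.T_pow,
        ← Algebra.smul_def, mul_smul]
    have hne := constTerm_mul_aeval_mul_aeval_ne_zero p hf0
      (fun b hb => hroots b (heval b ▸ hb)) hre
    rw [haeval, haeval] at hne
    simp only [mul_one, mul_neg] at hne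
    exact hne (hvanish w hw)
end
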